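/- arXiv:2307.02193 — 7 statements merged into one kernel-verified Lean document; each statement's English description precedes it below -/
import Mathlib

section
/- Let f : [0,1]^n → ℝ be Lipschitz continuous and let f* = R_n R_{n-1} ⋯ R_1 f be its monotone rearrangement, where R_i is the rearrangement operator in direction i. Then E[|f − f*|] ≤ 2 · E[‖∇⁻f‖₁], where expectations are over the uniform (Lebesgue) measure on [0,1]^n. -/
open MeasureTheory

/-- The (lower) level set `{y ∈ [0,m] : g y ≤ c}`. -/
def levelSet (m : ℝ) (g : ℝ → ℝ) (c : ℝ) : Set ℝ :=
  {y : ℝ | y ∈ Set.Icc 0 m ∧ g y ≤ c}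

/-- One-dimensional non-symmetric non-decreasing monotone rearrangement of `g` on `[0,m]`:
`g* x = inf {c : x ∈ (levelSet m g c)*}`, where `S* = [0, ν S]` for nonempty `S` and
`∅* = ∅`. -/
noncomputable def rearr1 (m : ℝ) (g : ℝ → ℝ) (x : ℝ) : ℝ :=
  sInf {c : ℝ | (levelSet m g c).Nonempty ∧ 0 ≤ x ∧
    ENNReal.ofReal x ≤ volume (levelSet m g c)}

/-- The rearrangement operator in direction `i` on the box `[0,a₁] × ⋯ × [0,aₙ]`: on every
line in direction `i`, it is the one-dimensional monotone rearrangement of the restriction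
of `f` to that line. -/
noncomputable def rearrDir {n : ℕ} (a : Fin n → ℝ) (i : Fin n) (f : (Fin n → ℝ) → ℝ) :
    (Fin n → ℝ) → ℝ :=
  fun x => rearr1 (a i) (fun t => f (Function.update x i t)) (x i)

/-- The monotone rearrangement `f* = Rₙ Rₙ₋₁ ⋯ R₁ f`. -/
noncomputable def monoRearr {n : ℕ} (a : Fin n → ℝ) (f : (Fin n → ℝ) → ℝ) :
    (Fin n → ℝ) → ℝ :=
  (List.finRange n).foldl (fun g i => rearrDir a i g) f

/-- The partial derivative of `f` in coordinate `i` at `x` (junk value where the line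
restriction of `f` is not differentiable). -/
noncomputable def pdiff {n : ℕ} (i : Fin n) (f : (Fin n → ℝ) → ℝ) (x : Fin n → ℝ) : ℝ :=
  deriv (fun t => f (Function.update x i t)) (x i)

/-- Lebesgue measure on the half-open unit interval. -/
noncomputable def unitMeasure : Measure ℝ := volume.restrict (Set.Ioc 0 1)

instance : IsProbabilityMeasure unitMeasure :=
  ⟨by simp [unitMeasure]⟩

theorem unitMeasure_real_Ioc {a b : ℝ} (ha : 0 ≤ a) (hab : a ≤ b) (hb : b ≤ 1) :
    unitMeasure.real (Set.Ioc a b) = b - a := by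
  rw [unitMeasure, measureReal_restrict_apply measurableSet_Ioc,
    Set.inter_eq_left.2 (Set.Ioc_subset_Ioc ha hb), Real.volume_real_Ioc_of_le hab]

theorem ae_unitMeasure : ∀ᵐ x ∂unitMeasure, x ∈ Set.Ioc (0 : ℝ) 1 :=
  ae_restrict_mem measurableSet_Ioc

/-- The monotone rearrangement on `(0,1]`, set to zero elsewhere. -/
noncomputable def unitRearr (g : ℝ → ℝ) (x : ℝ) : ℝ :=
  open Classical in
  if x ∈ Set.Ioc (0 : ℝ) 1 then sInf {c : ℝ | x ≤ unitMeasure.real {y | g y ≤ c}} else 0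

theorem rearr1_eq_unitRearr {g k : ℝ → ℝ} (hgk : Set.EqOn g k (Set.Ioc 0 1)) {x : ℝ}
    (hx : x ∈ Set.Ioc (0 : ℝ) 1) : rearr1 1 g x = unitRearr k x := by
  rw [rearr1, unitRearr, if_pos hx]
  congr 1
  ext c
  have hvol : volume (levelSet 1 g c) = unitMeasure {y | k y ≤ c} := by
    rw [unitMeasure, Measure.restrict_apply' measurableSet_Ioc]
    apply measure_congr
    have h0 : ∀ᵐ y : ℝ, y ≠ 0 := by simp [ae_iff]
    filter_upwards [h0] with y hy
    apply propext
    change (y ∈ Set.Icc (0 : ℝ) 1 ∧ g y ≤ c) ↔ (k y ≤ c ∧ y ∈ Set.Ioc (0 : ℝ) 1)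
    constructor
    · rintro ⟨⟨h1, h2⟩, h3⟩
      have hm : y ∈ Set.Ioc (0 : ℝ) 1 := ⟨lt_of_le_of_ne h1 hy.symm, h2⟩
      exact ⟨hgk hm ▸ h3, hm⟩
    · rintro ⟨h3, hm⟩
      exact ⟨⟨hm.1.le, hm.2⟩, (hgk hm).symm ▸ h3⟩
  simp only [Set.mem_ofPred_eq, hvol, Measure.real]
  rw [ENNReal.ofReal_le_iff_le_toReal (measure_ne_top _ _)]
  refine ⟨fun h => h.2.2, fun h => ⟨?_, hx.1.le, h⟩⟩
  apply nonempty_of_measure_ne_zero (μ := volume)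
  rw [hvol]
  intro h0
  rw [h0] at h
  exact absurd hx.1 (not_lt.2 h)

theorem unitMeasure_real_le_of_le {g : ℝ → ℝ} {M : ℝ} (hM : ∀ x, |g x| ≤ M) {c : ℝ}
    (hc : M ≤ c) : unitMeasure.real {y | g y ≤ c} = 1 := by
  have : {y | g y ≤ c} = Set.univ := by
    ext y; simpa using (le_of_abs_le (hM y)).trans hc
  rw [this, probReal_univ]

theorem neg_le_of_pos_unitMeasure_real {g : ℝ → ℝ} {M : ℝ} (hM : ∀ x, |g x| ≤ M) {c : ℝ}
    (hc : 0 < unitMeasure.real {y | g y ≤ c}) : -M ≤ c := by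
  by_contra! h
  have : {y | g y ≤ c} = ∅ := by
    ext y; simpa using h.trans_le (neg_le_of_abs_le (hM y))
  simp [this] at hc

theorem unitRearr_le_iff {g : ℝ → ℝ} (hg : Measurable g) {M : ℝ} (hM : ∀ x, |g x| ≤ M)
    {x : ℝ} (hx : x ∈ Set.Ioc (0 : ℝ) 1) {c : ℝ} :
    unitRearr g x ≤ c ↔ x ≤ unitMeasure.real {y | g y ≤ c} := by
  rw [unitRearr, if_pos hx]
  have hbdd : BddBelow {c : ℝ | x ≤ unitMeasure.real {y | g y ≤ c}} :=
    ⟨-M, fun c hc => neg_le_of_pos_unitMeasure_real hM (hx.1.trans_le hc)⟩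
  refine ⟨fun h => ?_, fun h => csInf_le hbdd h⟩
  have hne : {c : ℝ | x ≤ unitMeasure.real {y | g y ≤ c}}.Nonempty :=
    ⟨M, hx.2.trans_eq (unitMeasure_real_le_of_le hM le_rfl).symm⟩
  have : IsProbabilityMeasure (unitMeasure.map g) :=
    Measure.isProbabilityMeasure_map hg.aemeasurable
  have hcdf (c : ℝ) : ProbabilityTheory.cdf (unitMeasure.map g) c =
      unitMeasure.real {y | g y ≤ c} := by
    rw [ProbabilityTheory.cdf_eq_real, map_measureReal_apply hg measurableSet_Iic]
    rfl
  rw [← hcdf]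
  have hlim := ((ProbabilityTheory.cdf (unitMeasure.map g)).right_continuous c).mono
    Set.Ioi_subset_Ici_self
  refine ge_of_tendsto hlim.tendsto ?_
  filter_upwards [self_mem_nhdsWithin] with d hd
  obtain ⟨a, ha, had⟩ := exists_lt_of_csInf_lt hne (h.trans_lt hd)
  have ha' : x ≤ ProbabilityTheory.cdf (unitMeasure.map g) a := by rw [hcdf]; exact ha
  exact ha'.trans (ProbabilityTheory.monotone_cdf _ had.le)

theorem abs_unitRearr_le {g : ℝ → ℝ} (hg : Measurable g) {M : ℝ} (hM : ∀ x, |g x| ≤ M)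
    (x : ℝ) : |unitRearr g x| ≤ M := by
  by_cases hx : x ∈ Set.Ioc (0 : ℝ) 1
  · rw [abs_le]
    constructor
    · exact neg_le_of_pos_unitMeasure_real hM
        (hx.1.trans_le ((unitRearr_le_iff hg hM hx).1 le_rfl))
    · rw [unitRearr_le_iff hg hM hx, unitMeasure_real_le_of_le hM le_rfl]
      exact hx.2
  · simpa only [unitRearr, if_neg hx, abs_zero, zero_add] using (abs_nonneg _).trans (hM 0)

theorem unitRearr_le_add {g k : ℝ → ℝ} (hg : Measurable g) (hk : Measurable k) {M N ε : ℝ}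
    (hM : ∀ x, |g x| ≤ M) (hN : ∀ x, |k x| ≤ N) (hε : 0 ≤ ε) (h : ∀ x, g x ≤ k x + ε) (x : ℝ) :
    unitRearr g x ≤ unitRearr k x + ε := by
  by_cases hx : x ∈ Set.Ioc (0 : ℝ) 1
  · rw [unitRearr_le_iff hg hM hx]
    refine ((unitRearr_le_iff hk hN hx).1 le_rfl).trans (measureReal_mono fun y hy => ?_)
    simp only [Set.mem_ofPred_eq] at hy ⊢
    linarith [h y]
  · simpa only [unitRearr, if_neg hx, abs_zero, zero_add] using hε

theorem measurable_unitRearr {X : Type*} [MeasurableSpace X] {F : X → ℝ → ℝ}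
    (hF : Measurable F.uncurry) {M : ℝ} (hM : ∀ x t, |F x t| ≤ M) :
    Measurable fun p : X × ℝ => unitRearr (F p.1) p.2 := by
  refine measurable_of_Iic fun c => ?_
  have hlevel : Measurable fun x : X => unitMeasure.real {t | F x t ≤ c} :=
    (measurable_measure_prodMk_left (ν := unitMeasure) (s := {p : X × ℝ | F p.1 p.2 ≤ c})
      (measurableSet_le hF measurable_const)).ennreal_toReal
  have hcube : MeasurableSet {p : X × ℝ | p.2 ∈ Set.Ioc (0 : ℝ) 1} :=
    measurable_snd measurableSet_Ioc
  have hle : MeasurableSet {p : X × ℝ | p.2 ≤ unitMeasure.real {t | F p.1 t ≤ c}} :=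
    measurableSet_le measurable_snd (hlevel.comp measurable_fst)
  have heq : (fun p : X × ℝ => unitRearr (F p.1) p.2) ⁻¹' Set.Iic c =
      ({p : X × ℝ | p.2 ∈ Set.Ioc (0 : ℝ) 1} ∩
        {p : X × ℝ | p.2 ≤ unitMeasure.real {t | F p.1 t ≤ c}}) ∪
      ({p : X × ℝ | p.2 ∈ Set.Ioc (0 : ℝ) 1}ᶜ ∩ {_p | 0 ≤ c}) := by
    ext ⟨x, t⟩
    by_cases ht : t ∈ Set.Ioc (0 : ℝ) 1
    · have := unitRearr_le_iff (g := F x) hF.of_uncurry_left (hM x) ht (c := c)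
      simp only [Set.mem_preimage, Set.mem_Iic, this]
      simp [-Set.mem_Ioc, ht]
    · simp [-Set.mem_Ioc, ht, unitRearr]
  rw [heq]
  exact (hcube.inter hle).union (hcube.compl.inter (MeasurableSet.const _))

theorem measurable_unitRearr_apply {g : ℝ → ℝ} (hg : Measurable g) {M : ℝ}
    (hM : ∀ x, |g x| ≤ M) : Measurable (unitRearr g) :=
  (measurable_unitRearr (X := Unit) (F := fun _ => g) (hg.comp measurable_snd)
    (fun _ => hM)).comp (measurable_prodMk_left (x := ()))

theorem map_unitRearr {g : ℝ → ℝ} (hg : Measurable g) {M : ℝ} (hM : ∀ x, |g x| ≤ M) :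
    unitMeasure.map (unitRearr g) = unitMeasure.map g := by
  have hr := measurable_unitRearr_apply hg hM
  have := Measure.isProbabilityMeasure_map (μ := unitMeasure) hr.aemeasurable
  refine Measure.ext_of_Iic _ _ fun c => ?_
  rw [Measure.map_apply hr measurableSet_Iic, Measure.map_apply hg measurableSet_Iic]
  rw [← measureReal_eq_measureReal_iff]
  set a := unitMeasure.real (g ⁻¹' Set.Iic c)
  have ha : a ≤ 1 := measureReal_le_one
  have hset : (unitRearr g ⁻¹' Set.Iic c) =ᵐ[unitMeasure] Set.Ioc 0 a := by
    filter_upwards [ae_unitMeasure] with x hx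
    apply propext
    refine (unitRearr_le_iff hg hM hx).trans ⟨fun h => ⟨hx.1, h⟩, fun h => h.2⟩
  rw [measureReal_congr hset, unitMeasure_real_Ioc le_rfl measureReal_nonneg ha, sub_zero]

theorem integrable_of_abs_le {X : Type*} [MeasurableSpace X] {μ : Measure X} [IsFiniteMeasure μ]
    {g : X → ℝ} (hg : Measurable g) {M : ℝ} (hM : ∀ x, |g x| ≤ M) : Integrable g μ :=
  Integrable.of_bound hg.aestronglyMeasurable M (Filter.Eventually.of_forall hM)

theorem integral_unitRearr {g : ℝ → ℝ} (hg : Measurable g) {M : ℝ} (hM : ∀ x, |g x| ≤ M) :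
    ∫ x, unitRearr g x ∂unitMeasure = ∫ x, g x ∂unitMeasure := by
  have hr := measurable_unitRearr_apply hg hM
  have h1 := integral_map (μ := unitMeasure) hr.aemeasurable
    (f := id) measurable_id.aestronglyMeasurable
  have h2 := integral_map (μ := unitMeasure) hg.aemeasurable
    (f := id) measurable_id.aestronglyMeasurable
  rw [map_unitRearr hg hM] at h1
  exact h1.symm.trans h2

theorem integral_posPart_unitRearr_sub_le {g k : ℝ → ℝ} (hg : Measurable g) (hk : Measurable k)
    {M : ℝ} (hM : ∀ x, |g x| ≤ M) (hN : ∀ x, |k x| ≤ M) :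
    ∫ x, max 0 (unitRearr g x - unitRearr k x) ∂unitMeasure ≤
      ∫ x, max 0 (g x - k x) ∂unitMeasure := by
  have hm : Measurable fun x => max (g x) (k x) := hg.max hk
  have hmM (x : ℝ) : |max (g x) (k x)| ≤ M := abs_max_le_max_abs_abs.trans (max_le (hM x) (hN x))
  have ig := integrable_of_abs_le (μ := unitMeasure) (measurable_unitRearr_apply hg hM)
    (abs_unitRearr_le hg hM)
  have ik := integrable_of_abs_le (μ := unitMeasure) (measurable_unitRearr_apply hk hN)
    (abs_unitRearr_le hk hN)
  have im := integrable_of_abs_le (μ := unitMeasure) (measurable_unitRearr_apply hm hmM)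
    (abs_unitRearr_le hm hmM)
  calc ∫ x, max 0 (unitRearr g x - unitRearr k x) ∂unitMeasure
      ≤ ∫ x, (unitRearr (fun x => max (g x) (k x)) x - unitRearr k x) ∂unitMeasure := by
        refine integral_mono ((integrable_zero _ _ _).sup (ig.sub ik)) (im.sub ik) fun x => ?_
        have h1 := unitRearr_le_add hg hm hM hmM le_rfl (fun x => by simp) x
        have h2 := unitRearr_le_add hk hm hN hmM le_rfl (fun x => by simp) x
        exact max_le (by linarith) (by linarith)
    _ = ∫ x, (max (g x) (k x) - k x) ∂unitMeasure := by
        rw [integral_sub im ik, integral_unitRearr hm hmM, integral_unitRearr hk hN,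
          integral_sub (integrable_of_abs_le hm hmM) (integrable_of_abs_le hk hN)]
    _ = ∫ x, max 0 (g x - k x) ∂unitMeasure := by
        congr 1; ext x
        rw [max_comm 0, ← max_sub_sub_right, sub_self]

theorem integral_unitMeasure (g : ℝ → ℝ) : ∫ x, g x ∂unitMeasure = ∫ x in (0 : ℝ)..1, g x :=
  (intervalIntegral.integral_of_le zero_le_one).symm

theorem integral_posPart_sub_shift_le {φ : ℝ → ℝ} {L : NNReal} (hφ : LipschitzWith L φ)
    (hconst : ∀ x, 1 ≤ x → φ x = φ 1) {h : ℝ} (hh : 0 ≤ h) :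
    ∫ x, max 0 (φ x - φ (x + h)) ∂unitMeasure ≤
      h * ∫ x, |min 0 (deriv φ x)| ∂unitMeasure := by
  set ψ : ℝ → ℝ := fun x => |min 0 (deriv φ x)| with hψ
  have hψ0 (x : ℝ) : 0 ≤ ψ x := abs_nonneg _
  have hψm : Measurable ψ := by
    have := measurable_deriv φ
    exact (measurable_const.min this).abs
  have hψb (x : ℝ) : ‖ψ x‖ ≤ L := by
    have h1 := norm_deriv_le_of_lipschitz hφ (x₀ := x)
    rw [Real.norm_eq_abs] at h1 ⊢
    rw [hψ, abs_abs]
    rcases min_cases 0 (deriv φ x) with h2 | h2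
    · rw [h2.1, abs_zero]; exact L.2
    · rwa [h2.1]
  have iψ (a b : ℝ) : IntervalIntegrable ψ volume a b :=
    (intervalIntegrable_const (c := (L : ℝ))).mono_fun hψm.aestronglyMeasurable
      (Filter.Eventually.of_forall fun x => (hψb x).trans (le_abs_self _))
  set G : ℝ → ℝ := fun y => ∫ t in (0 : ℝ)..y, ψ t with hG
  have hGc : Continuous G := intervalIntegral.continuous_primitive iψ 0
  have hstep (x y : ℝ) (hxy : x ≤ y) : φ x - φ y ≤ G y - G x := by
    have hac : AbsolutelyContinuousOnInterval φ x y :=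
      (hφ.lipschitzOnWith (s := Set.uIcc x y)).absolutelyContinuousOnInterval
    have h1 := hac.integral_deriv_eq_sub
    have h2 : G y - G x = ∫ t in x..y, ψ t :=
      intervalIntegral.integral_interval_sub_left (iψ _ _) (iψ _ _)
    have h3 : -∫ t in x..y, deriv φ t ≤ ∫ t in x..y, ψ t := by
      rw [← intervalIntegral.integral_neg]
      refine intervalIntegral.integral_mono hxy hac.intervalIntegrable_deriv.neg (iψ _ _)
        fun t => ?_
      exact (neg_le_neg (min_le_right 0 _)).trans (neg_le_abs _)
    linarith
  have hGmono (x y : ℝ) (hxy : x ≤ y) : 0 ≤ G y - G x := by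
    have h2 : G y - G x = ∫ t in x..y, ψ t :=
      intervalIntegral.integral_interval_sub_left (iψ _ _) (iψ _ _)
    rw [h2]
    exact intervalIntegral.integral_nonneg hxy fun t _ => hψ0 t
  have hGtail (y : ℝ) (hy : 1 ≤ y) : G y = G 1 := by
    have h2 : G y - G 1 = ∫ t in (1 : ℝ)..y, ψ t :=
      intervalIntegral.integral_interval_sub_left (iψ _ _) (iψ _ _)
    have h3 : ∫ t in (1 : ℝ)..y, ψ t = 0 := by
      rw [intervalIntegral.integral_of_le hy]
      refine setIntegral_eq_zero_of_forall_eq_zero fun t ht => ?_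
      have : φ =ᶠ[nhds t] fun _ => φ 1 := by
        filter_upwards [lt_mem_nhds ht.1] with s hs using hconst s hs.le
      simp [hψ, this.deriv_eq]
    linarith
  rw [integral_unitMeasure, integral_unitMeasure]
  have hφc := hφ.continuous
  have hGi (a b : ℝ) : IntervalIntegrable G volume a b := hGc.intervalIntegrable _ _
  calc ∫ x in (0 : ℝ)..1, max 0 (φ x - φ (x + h))
      ≤ ∫ x in (0 : ℝ)..1, (G (x + h) - G x) := by
        refine intervalIntegral.integral_mono zero_le_one
          (Continuous.intervalIntegrable (by fun_prop) _ _)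
          (Continuous.intervalIntegrable (by fun_prop) _ _) fun x => ?_
        exact max_le (hGmono _ _ (by linarith)) (hstep _ _ (by linarith))
    _ = (∫ x in (1 : ℝ)..1 + h, G x) - ∫ x in (0 : ℝ)..h, G x := by
        rw [intervalIntegral.integral_sub (Continuous.intervalIntegrable (by fun_prop) _ _)
          (hGi _ _), intervalIntegral.integral_comp_add_right, zero_add,
          intervalIntegral.integral_interval_sub_interval_comm' (hGi _ _) (hGi _ _) (hGi _ _)]
    _ ≤ (∫ x in (1 : ℝ)..1 + h, G x) - 0 := by
        refine sub_le_sub_left (intervalIntegral.integral_nonneg hh fun x hx => ?_) _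
        exact intervalIntegral.integral_nonneg hx.1 fun t _ => hψ0 t
    _ = h * G 1 := by
        rw [intervalIntegral.integral_congr (g := fun _ => G 1)]
        · simp
        · intro x hx
          rw [Set.uIcc_of_le (by linarith)] at hx
          exact hGtail x hx.1

theorem sub_le_of_integral_posPart_shift {φ : ℝ → ℝ} {L : NNReal} (hφ : LipschitzWith L φ)
    {h : ℝ} (hh : 0 < h) {x y : ℝ} (hx : 0 ≤ x) (hxy : x ≤ y) (hy : y ≤ 1) :
    φ x - φ y ≤ (∫ t, max 0 (φ t - φ (t + h)) ∂unitMeasure) / h + 2 * L * h := by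
  have hφc := hφ.continuous
  have hi (a b : ℝ) : IntervalIntegrable φ volume a b := hφc.intervalIntegrable _ _
  have hdist (s t : ℝ) (hst : s ≤ t) (hth : t ≤ s + h) : |φ t - φ s| ≤ L * h := by
    have h1 := hφ.dist_le_mul t s
    rw [Real.dist_eq, Real.dist_eq, abs_of_nonneg (sub_nonneg.2 hst)] at h1
    exact h1.trans (mul_le_mul_of_nonneg_left (by linarith) L.2)
  have h1 : ∫ t in x..y, (φ t - φ (t + h)) ≤ ∫ t, max 0 (φ t - φ (t + h)) ∂unitMeasure := by
    rw [integral_unitMeasure]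
    calc ∫ t in x..y, (φ t - φ (t + h)) ≤ ∫ t in x..y, max 0 (φ t - φ (t + h)) :=
          intervalIntegral.integral_mono hxy (Continuous.intervalIntegrable (by fun_prop) _ _)
            (Continuous.intervalIntegrable (by fun_prop) _ _) fun t => le_max_right _ _
      _ ≤ ∫ t in (0 : ℝ)..1, max 0 (φ t - φ (t + h)) :=
          intervalIntegral.integral_mono_interval hx hxy hy
            (Filter.Eventually.of_forall fun t => le_max_left _ _)
            (Continuous.intervalIntegrable (by fun_prop) _ _)
  have h2 : ∫ t in x..y, (φ t - φ (t + h)) =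
      (∫ t in x..x + h, φ t) - ∫ t in y..y + h, φ t := by
    rw [intervalIntegral.integral_sub (hi _ _) (Continuous.intervalIntegrable (by fun_prop) _ _),
      intervalIntegral.integral_comp_add_right,
      intervalIntegral.integral_interval_sub_interval_comm (hi _ _) (hi _ _) (hi _ _)]
  have h3 : h * (φ x - L * h) ≤ ∫ t in x..x + h, φ t := by
    have := intervalIntegral.integral_mono_on (a := x) (b := x + h) (by linarith)
      (intervalIntegrable_const (c := φ x - L * h)) (hi _ _)
      fun t ht => by linarith [neg_le_of_abs_le (hdist x t ht.1 ht.2)]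
    rwa [intervalIntegral.integral_const, add_sub_cancel_left, smul_eq_mul] at this
  have h4 : ∫ t in y..y + h, φ t ≤ h * (φ y + L * h) := by
    have := intervalIntegral.integral_mono_on (a := y) (b := y + h) (by linarith) (hi _ _)
      (intervalIntegrable_const (c := φ y + L * h))
      fun t ht => by linarith [le_of_abs_le (hdist y t ht.1 ht.2)]
    rwa [intervalIntegral.integral_const, add_sub_cancel_left, smul_eq_mul] at this
  rw [← sub_le_iff_le_add, le_div_iff₀ hh]
  nlinarith

theorem abs_sub_unitRearr_le {φ : ℝ → ℝ} {L : NNReal} (hφ : LipschitzWith L φ) {M : ℝ}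
    (hM : ∀ x, |φ x| ≤ M) {h : ℝ} (hh : 0 < h) {x : ℝ} (hx : x ∈ Set.Ioc (0 : ℝ) 1) :
    |φ x - unitRearr φ x| ≤
      (∫ t, max 0 (φ t - φ (t + h)) ∂unitMeasure) / h + 3 * L * h := by
  set W := (∫ t, max 0 (φ t - φ (t + h)) ∂unitMeasure) / h + 2 * L * h with hW
  have hvar {s t : ℝ} (hs : 0 ≤ s) (hst : s ≤ t) (ht : t ≤ 1) : φ s - φ t ≤ W :=
    sub_le_of_integral_posPart_shift hφ hh hs hst ht
  have hLh : 0 ≤ L * h := mul_nonneg L.2 hh.le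
  have hmeas := hφ.continuous.measurable
  have hupper : unitRearr φ x ≤ φ x + W := by
    rw [unitRearr_le_iff hmeas hM hx]
    calc x = unitMeasure.real (Set.Ioc 0 x) := by
          rw [unitMeasure_real_Ioc le_rfl hx.1.le hx.2, sub_zero]
      _ ≤ _ := measureReal_mono fun y hy => by
          have := hvar hy.1.le hy.2 hx.2
          change φ y ≤ φ x + W
          linarith
  have hlower : φ x ≤ unitRearr φ x + W + L * h := by
    have hlev := (unitRearr_le_iff hmeas hM hx).1 (le_refl (unitRearr φ x))
    obtain ⟨y, hy1, hy2, hy3⟩ : ∃ y, max 0 (x - h) ≤ y ∧ y ≤ 1 ∧ φ y ≤ unitRearr φ x := by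
      by_contra! hcon
      have hsub : {y | φ y ≤ unitRearr φ x} ≤ᵐ[unitMeasure] Set.Ioc 0 (max 0 (x - h)) := by
        filter_upwards [ae_unitMeasure] with y hy hyl
        refine ⟨hy.1, ?_⟩
        by_contra! hlt
        exact absurd hyl (not_le.2 (hcon y hlt.le hy.2))
      have h1 : unitMeasure.real {y | φ y ≤ unitRearr φ x} ≤
          unitMeasure.real (Set.Ioc 0 (max 0 (x - h))) :=
        ENNReal.toReal_mono (measure_ne_top _ _) (measure_mono_ae hsub)
      rw [unitMeasure_real_Ioc le_rfl (le_max_left _ _)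
        (max_le zero_le_one (by linarith [hx.2])), sub_zero] at h1
      exact absurd (hlev.trans h1) (not_le.2 (max_lt hx.1 (by linarith)))
    rcases le_total x y with hxy | hxy
    · linarith [hvar hx.1.le hxy hy2]
    · have h1 := hφ.dist_le_mul x y
      rw [Real.dist_eq, Real.dist_eq, abs_of_nonneg (sub_nonneg.2 hxy)] at h1
      have h2 : (L : ℝ) * (x - y) ≤ L * h :=
        mul_le_mul_of_nonneg_left (by linarith [(le_max_right 0 (x - h)).trans hy1]) L.2
      have h3 := hvar hx.1.le le_rfl hx.2
      linarith [le_of_abs_le h1]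
  rw [abs_le]
  constructor <;> linarith

/-- The product of the unit interval measures on `ℝⁿ`. -/
noncomputable def cubeMeasure (n : ℕ) : Measure (Fin n → ℝ) :=
  Measure.pi fun _ => unitMeasure

instance (n : ℕ) : IsProbabilityMeasure (cubeMeasure n) := by
  unfold cubeMeasure; infer_instance

theorem measurable_update_uncurry {n : ℕ} (i : Fin n) :
    Measurable fun p : (Fin n → ℝ) × ℝ => Function.update p.1 i p.2 :=
  (continuous_fst.update i continuous_snd).measurable

theorem measurePreserving_update {n : ℕ} (i : Fin n) :
    MeasurePreserving (fun p : (Fin n → ℝ) × ℝ => Function.update p.1 i p.2)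
      ((cubeMeasure n).prod unitMeasure) (cubeMeasure n) := by
  refine ⟨measurable_update_uncurry i, (Measure.pi_eq fun s hs => ?_).symm⟩
  rw [Measure.map_apply (measurable_update_uncurry i) (.univ_pi hs)]
  have hpre : (fun p : (Fin n → ℝ) × ℝ => Function.update p.1 i p.2) ⁻¹' Set.univ.pi s =
      Set.univ.pi (Function.update s i Set.univ) ×ˢ s i := by
    ext ⟨x, t⟩
    simp only [Set.mem_preimage, Set.mem_pi, Set.mem_univ, true_imp_iff, Set.mem_prod]
    constructor
    · intro h
      refine ⟨fun k => ?_, by simpa using h i⟩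
      by_cases hk : k = i
      · subst hk; simp
      · simpa [hk] using h k
    · rintro ⟨h1, h2⟩ k
      by_cases hk : k = i
      · subst hk; simpa using h2
      · simpa [hk] using h1 k
  rw [hpre, Measure.prod_prod, cubeMeasure, Measure.pi_pi,
    ← Finset.prod_erase_mul _ _ (Finset.mem_univ i),
    ← Finset.prod_erase_mul _ (fun k => unitMeasure (s k)) (Finset.mem_univ i),
    Function.update_self, measure_univ, mul_one]
  congr 1
  refine Finset.prod_congr rfl fun k hk => ?_
  rw [Function.update_of_ne (Finset.ne_of_mem_erase hk)]

theorem integral_cubeMeasure_update {n : ℕ} (i : Fin n) {F : (Fin n → ℝ) → ℝ}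
    (hF : Measurable F) {M : ℝ} (hM : ∀ x, |F x| ≤ M) :
    ∫ x, F x ∂cubeMeasure n =
      ∫ x, ∫ t, F (Function.update x i t) ∂unitMeasure ∂cubeMeasure n := by
  have h := measurePreserving_update i
  have h1 := integral_map (μ := (cubeMeasure n).prod unitMeasure) h.measurable.aemeasurable
    (f := F) hF.aestronglyMeasurable
  rw [h.map_eq] at h1
  exact h1.trans (integral_prod _ (integrable_of_abs_le (hF.comp h.measurable) fun _ => hM _))

theorem integrable_integral_update {n : ℕ} (i : Fin n) {F : (Fin n → ℝ) → ℝ}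
    (hF : Measurable F) {M : ℝ} (hM : ∀ x, |F x| ≤ M) :
    Integrable (fun x => ∫ t, F (Function.update x i t) ∂unitMeasure) (cubeMeasure n) :=
  (integrable_of_abs_le (hF.comp (measurable_update_uncurry i)) fun _ => hM _).integral_prod_left
    (μ := cubeMeasure n) (ν := unitMeasure)

theorem integral_cubeMeasure_mono_lines {n : ℕ} (i : Fin n) {F G : (Fin n → ℝ) → ℝ}
    (hF : Measurable F) (hG : Measurable G) {M N : ℝ} (hM : ∀ x, |F x| ≤ M) (hN : ∀ x, |G x| ≤ N)
    (h : ∀ x, ∫ t, F (Function.update x i t) ∂unitMeasure ≤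
      ∫ t, G (Function.update x i t) ∂unitMeasure) :
    ∫ x, F x ∂cubeMeasure n ≤ ∫ x, G x ∂cubeMeasure n := by
  rw [integral_cubeMeasure_update i hF hM, integral_cubeMeasure_update i hG hN]
  exact integral_mono (integrable_integral_update i hF hM) (integrable_integral_update i hG hN) h

/-- Rearrangement in direction `j` on the half-open unit cube. -/
noncomputable def cubeRearr {n : ℕ} (j : Fin n) (u : (Fin n → ℝ) → ℝ) : (Fin n → ℝ) → ℝ :=
  fun x => unitRearr (fun t => u (Function.update x j t)) (x j)

/-- `u` is measurable, bounded by `M`, and `L`-Lipschitz in every direction of `l`. -/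
structure LipschitzAlong {n : ℕ} (l : List (Fin n)) (M : ℝ) (L : NNReal)
    (u : (Fin n → ℝ) → ℝ) : Prop where
  measurable : Measurable u
  abs_le : ∀ x, |u x| ≤ M
  lipschitz : ∀ i ∈ l, ∀ x, LipschitzWith L fun t => u (Function.update x i t)

theorem measurable_comp_update {n : ℕ} {u : (Fin n → ℝ) → ℝ} (hu : Measurable u) (x : Fin n → ℝ)
    (j : Fin n) : Measurable fun t => u (Function.update x j t) :=
  hu.comp (measurable_update x)

theorem LipschitzAlong.cubeRearr {n : ℕ} {l : List (Fin n)} {j : Fin n} (hj : j ∉ l) {M : ℝ}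
    {L : NNReal} {u : (Fin n → ℝ) → ℝ} (hu : LipschitzAlong (j :: l) M L u) :
    LipschitzAlong l M L (cubeRearr j u) where
  measurable :=
    (measurable_unitRearr (F := fun x t => u (Function.update x j t))
      (hu.measurable.comp (measurable_update_uncurry j)) fun x t => hu.abs_le _).comp
      (measurable_id.prodMk (measurable_pi_apply j))
  abs_le x := abs_unitRearr_le (measurable_comp_update hu.measurable x j) (fun _ => hu.abs_le _) _
  lipschitz i hi x := by
    have hij : i ≠ j := fun h => hj (h ▸ hi)
    refine LipschitzWith.of_le_add_mul L fun s t => ?_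
    simp only [_root_.cubeRearr, Function.update_of_ne hij.symm]
    refine unitRearr_le_add (measurable_comp_update hu.measurable _ j)
      (measurable_comp_update hu.measurable _ j) (fun _ => hu.abs_le _) (fun _ => hu.abs_le _)
      (by positivity) (fun r => ?_) _
    rw [Function.update_comm hij, Function.update_comm hij]
    have := (hu.lipschitz i (List.mem_cons_of_mem _ hi) (Function.update x j r)).dist_le_mul s t
    rw [Real.dist_eq] at this
    linarith [le_of_abs_le this]

/-- The integrated decrease of `u` along steps of length `h` in direction `i`. -/
noncomputable def stepDecrease {n : ℕ} (i : Fin n) (h : ℝ) (u : (Fin n → ℝ) → ℝ) : ℝ :=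
  ∫ x, max 0 (u x - u (Function.update x i (x i + h))) ∂cubeMeasure n

theorem measurable_posPart_sub_shift {n : ℕ} (i : Fin n) (h : ℝ) {u : (Fin n → ℝ) → ℝ}
    (hu : Measurable u) :
    Measurable fun x => max 0 (u x - u (Function.update x i (x i + h))) := by
  have : Continuous fun x : Fin n → ℝ => Function.update x i (x i + h) :=
    continuous_id.update i ((continuous_apply i).add continuous_const)
  exact measurable_const.max (hu.sub (hu.comp this.measurable))

theorem abs_posPart_sub_le {a b M : ℝ} (ha : |a| ≤ M) (hb : |b| ≤ M) :
    |max 0 (a - b)| ≤ 2 * M := by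
  rw [abs_of_nonneg (le_max_left _ _)]
  rw [abs_le] at ha hb
  exact max_le (by linarith) (by linarith)

theorem stepDecrease_cubeRearr_le {n : ℕ} {i j : Fin n} (hij : i ≠ j) (h : ℝ)
    {l : List (Fin n)} (hj : j ∉ l) {M : ℝ} {L : NNReal} {u : (Fin n → ℝ) → ℝ}
    (hu : LipschitzAlong (j :: l) M L u) :
    stepDecrease i h (cubeRearr j u) ≤ stepDecrease i h u := by
  have hr := hu.cubeRearr hj
  refine integral_cubeMeasure_mono_lines j (measurable_posPart_sub_shift i h hr.measurable)
    (measurable_posPart_sub_shift i h hu.measurable)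
    (fun x => abs_posPart_sub_le (hr.abs_le _) (hr.abs_le _))
    (fun x => abs_posPart_sub_le (hu.abs_le _) (hu.abs_le _)) fun x => ?_
  have key := integral_posPart_unitRearr_sub_le (M := M)
    (measurable_comp_update hu.measurable x j)
    (measurable_comp_update hu.measurable (Function.update x i (x i + h)) j)
    (fun _ => hu.abs_le _) (fun _ => hu.abs_le _)
  simpa only [cubeRearr, Function.update_of_ne hij, Function.update_of_ne hij.symm,
    Function.update_self, Function.update_idem, Function.update_comm hij.symm] using key

theorem integral_abs_sub_cubeRearr_le {n : ℕ} {i : Fin n} {l : List (Fin n)} (hi : i ∉ l)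
    {M : ℝ} {L : NNReal} {u : (Fin n → ℝ) → ℝ} (hu : LipschitzAlong (i :: l) M L u) {c : ℝ}
    (hc : ∀ h, 0 < h → stepDecrease i h u ≤ h * c) :
    ∫ x, |u x - cubeRearr i u x| ∂cubeMeasure n ≤ c := by
  have hr := hu.cubeRearr hi
  have hmeas : Measurable fun x => |u x - cubeRearr i u x| :=
    (hu.measurable.sub hr.measurable).abs
  have hbdd (x) : |(|u x - cubeRearr i u x|)| ≤ M + M := by
    rw [abs_abs]
    exact (abs_sub _ _).trans (add_le_add (hu.abs_le x) (hr.abs_le x))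
  have hstep (h : ℝ) (hh : 0 < h) :
      ∫ x, |u x - cubeRearr i u x| ∂cubeMeasure n ≤ c + 3 * L * h := by
    set F : (Fin n → ℝ) → ℝ := fun x => max 0 (u x - u (Function.update x i (x i + h))) with hF
    have hFm : Measurable F := measurable_posPart_sub_shift i h hu.measurable
    have hFb (x) : |F x| ≤ 2 * M := abs_posPart_sub_le (hu.abs_le _) (hu.abs_le _)
    rw [integral_cubeMeasure_update i hmeas hbdd]
    calc ∫ x, ∫ t, |u (Function.update x i t) - cubeRearr i u (Function.update x i t)|
            ∂unitMeasure ∂cubeMeasure n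
        ≤ ∫ x, ((∫ t, F (Function.update x i t) ∂unitMeasure) / h + 3 * L * h)
            ∂cubeMeasure n := by
          refine integral_mono (integrable_integral_update i hmeas hbdd)
            (((integrable_integral_update i hFm hFb).div_const h).add (integrable_const _))
            fun x => ?_
          have hline (t : ℝ) (ht : t ∈ Set.Ioc (0 : ℝ) 1) :=
            abs_sub_unitRearr_le (hu.lipschitz i List.mem_cons_self x)
              (fun _ => hu.abs_le _) hh ht
          calc ∫ t, |u (Function.update x i t) - cubeRearr i u (Function.update x i t)|
                  ∂unitMeasure
              ≤ ∫ t, ((∫ t, F (Function.update x i t) ∂unitMeasure) / h + 3 * L * h)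
                  ∂unitMeasure := by
                refine integral_mono_ae (integrable_of_abs_le
                  (measurable_comp_update hmeas x i) fun t => hbdd _) (integrable_const _) ?_
                filter_upwards [ae_unitMeasure] with t ht
                simpa only [cubeRearr, hF, Function.update_self, Function.update_idem]
                  using hline t ht
            _ = _ := by simp
      _ = stepDecrease i h u / h + 3 * L * h := by
          rw [integral_add ((integrable_integral_update i hFm hFb).div_const h)
            (integrable_const _), integral_div, ← integral_cubeMeasure_update i hFm hFb]
          simp [stepDecrease, hF]
      _ ≤ c + 3 * L * h := by
          have : stepDecrease i h u / h ≤ c := (div_le_iff₀' hh).2 (hc h hh)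
          linarith
  refine le_of_forall_pos_le_add fun ε hε => ?_
  have hpos : (0 : ℝ) < 3 * L + 1 := by positivity
  refine (hstep (ε / (3 * L + 1)) (by positivity)).trans ?_
  have h1 : (3 * L + 1) * (ε / (3 * L + 1)) = ε := mul_div_cancel₀ ε hpos.ne'
  have h2 : 0 < ε / (3 * L + 1) := by positivity
  linarith

theorem integral_abs_sub_foldl_cubeRearr_le {n : ℕ} {M : ℝ} {L : NNReal} {c : Fin n → ℝ}
    {l : List (Fin n)} (hl : l.Nodup) {u : (Fin n → ℝ) → ℝ} (hu : LipschitzAlong l M L u)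
    (hc : ∀ i ∈ l, ∀ h, 0 < h → stepDecrease i h u ≤ h * c i) :
    LipschitzAlong [] M L (l.foldl (fun g i => cubeRearr i g) u) ∧
      ∫ x, |u x - l.foldl (fun g i => cubeRearr i g) u x| ∂cubeMeasure n ≤ (l.map c).sum := by
  induction l generalizing u with
  | nil => exact ⟨hu, by simp⟩
  | cons j l ih =>
    rw [List.nodup_cons] at hl
    have hr := hu.cubeRearr hl.1
    obtain ⟨hv, hint⟩ := ih hl.2 hr fun i hi h hh =>
      (stepDecrease_cubeRearr_le (ne_of_mem_of_not_mem hi hl.1) h hl.1 hu).trans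
        (hc i (List.mem_cons_of_mem _ hi) h hh)
    refine ⟨hv, ?_⟩
    have hfirst := integral_abs_sub_cubeRearr_le hl.1 hu (hc j List.mem_cons_self)
    rw [List.foldl_cons, List.map_cons, List.sum_cons]
    have iu := integrable_of_abs_le (μ := cubeMeasure n) hu.measurable hu.abs_le
    have ir := integrable_of_abs_le (μ := cubeMeasure n) hr.measurable hr.abs_le
    have iv := integrable_of_abs_le (μ := cubeMeasure n) hv.measurable hv.abs_le
    refine le_trans ?_ (add_le_add hfirst hint)
    refine le_of_le_of_eq ?_ (integral_add (iu.sub ir).abs (ir.sub iv).abs)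
    exact integral_mono (iu.sub iv).abs ((iu.sub ir).abs.add (ir.sub iv).abs)
      fun x => abs_sub_le _ _ _

theorem eqOn_foldl_rearrDir {n : ℕ} (l : List (Fin n)) {u v : (Fin n → ℝ) → ℝ}
    (huv : Set.EqOn u v (Set.univ.pi fun _ => Set.Ioc 0 1)) :
    Set.EqOn (l.foldl (fun g i => rearrDir (fun _ => 1) i g) u)
      (l.foldl (fun g i => cubeRearr i g) v) (Set.univ.pi fun _ => Set.Ioc 0 1) := by
  induction l generalizing u v with
  | nil => exact huv
  | cons j l ih =>
    refine ih fun x hx => rearr1_eq_unitRearr (fun t ht => huv fun k _ => ?_) (hx j trivial)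
    by_cases hk : k = j
    · subst hk
      simpa only [Function.update_self] using ht
    · simpa only [Function.update_of_ne hk] using hx k trivial

/-- Coordinatewise projection onto the unit cube. -/
noncomputable def cubeClamp {n : ℕ} (x : Fin n → ℝ) : Fin n → ℝ :=
  fun k => Set.projIcc (0 : ℝ) 1 zero_le_one (x k)

theorem cubeClamp_mem {n : ℕ} (x : Fin n → ℝ) : cubeClamp x ∈ Set.Icc (0 : Fin n → ℝ) 1 :=
  ⟨fun k => (Set.projIcc (0 : ℝ) 1 zero_le_one (x k)).2.1,
    fun k => (Set.projIcc (0 : ℝ) 1 zero_le_one (x k)).2.2⟩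

theorem cubeClamp_of_mem {n : ℕ} {x : Fin n → ℝ} (hx : x ∈ Set.Icc (0 : Fin n → ℝ) 1) :
    cubeClamp x = x := by
  ext k
  simp [cubeClamp, Set.projIcc_of_mem zero_le_one (⟨hx.1 k, hx.2 k⟩ : x k ∈ Set.Icc (0 : ℝ) 1)]

theorem lipschitzWith_cubeClamp {n : ℕ} : LipschitzWith 1 (cubeClamp (n := n)) := by
  refine LipschitzWith.of_dist_le_mul fun x y => ?_
  rw [NNReal.coe_one, one_mul]
  refine (dist_pi_le_iff dist_nonneg).2 fun k => ?_
  have h : dist (Set.projIcc (0 : ℝ) 1 zero_le_one (x k))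
      (Set.projIcc (0 : ℝ) 1 zero_le_one (y k)) ≤ _ :=
    (LipschitzWith.projIcc zero_le_one).dist_le_mul (x k) (y k)
  rw [NNReal.coe_one, one_mul] at h
  exact h.trans (dist_le_pi_dist x y k)

theorem lipschitzWith_update {n : ℕ} (x : Fin n → ℝ) (i : Fin n) :
    LipschitzWith 1 (Function.update x i) := by
  refine LipschitzWith.of_dist_le_mul fun s t => ?_
  rw [NNReal.coe_one, one_mul]
  refine (dist_pi_le_iff dist_nonneg).2 fun k => ?_
  by_cases hk : k = i
  · subst hk; simp
  · simp [hk]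

theorem cubeClamp_update_of_one_le {n : ℕ} (x : Fin n → ℝ) (i : Fin n) {t : ℝ} (ht : 1 ≤ t) :
    cubeClamp (Function.update x i t) = cubeClamp (Function.update x i 1) := by
  ext k
  by_cases hk : k = i
  · subst hk; simp [cubeClamp, Set.projIcc_of_right_le zero_le_one ht]
  · simp [cubeClamp, hk]

theorem restrict_Icc_eq_cubeMeasure (n : ℕ) :
    (volume : Measure (Fin n → ℝ)).restrict (Set.Icc 0 1) = cubeMeasure n := by
  have h : (Set.univ.pi fun _ : Fin n => Set.Ioc (0 : ℝ) 1) =ᵐ[volume] Set.Icc 0 1 :=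
    Measure.univ_pi_Ioc_ae_eq_Icc
  rw [← Measure.restrict_congr_set h, volume_pi, Measure.restrict_pi_pi]
  rfl

theorem ae_cubeMeasure_mem_Ioo (n : ℕ) :
    ∀ᵐ x ∂cubeMeasure n, x ∈ Set.univ.pi fun _ : Fin n => Set.Ioo (0 : ℝ) 1 := by
  have h : (Set.univ.pi fun _ : Fin n => Set.Ioo (0 : ℝ) 1) =ᵐ[volume] Set.Icc 0 1 :=
    Measure.univ_pi_Ioo_ae_eq_Icc
  rw [← restrict_Icc_eq_cubeMeasure, ← Measure.restrict_congr_set h]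
  exact ae_restrict_mem (.univ_pi fun _ => measurableSet_Ioo)

theorem pdiff_comp_cubeClamp {n : ℕ} (f : (Fin n → ℝ) → ℝ) (i : Fin n) {x : Fin n → ℝ}
    (hx : x ∈ Set.univ.pi fun _ : Fin n => Set.Ioo (0 : ℝ) 1) :
    pdiff i (f ∘ cubeClamp) x = pdiff i f x := by
  refine Filter.EventuallyEq.deriv_eq ?_
  filter_upwards [Ioo_mem_nhds (hx i trivial).1 (hx i trivial).2] with t ht
  have hmem (k : Fin n) : Function.update x i t k ∈ Set.Icc (0 : ℝ) 1 := by
    by_cases hk : k = i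
    · subst hk
      simpa only [Function.update_self] using Set.Ioo_subset_Icc_self ht
    · simpa only [Function.update_of_ne hk] using Set.Ioo_subset_Icc_self (hx k trivial)
  rw [Function.comp_apply, cubeClamp_of_mem ⟨fun k => (hmem k).1, fun k => (hmem k).2⟩]

theorem measurable_pdiff {n : ℕ} {u : (Fin n → ℝ) → ℝ} (hu : Continuous u) (i : Fin n) :
    Measurable (pdiff i u) :=
  (measurable_deriv_with_param (f := fun (x : Fin n → ℝ) t => u (Function.update x i t))
    (hu.comp (continuous_fst.update i continuous_snd))).comp
    (measurable_id.prodMk (measurable_pi_apply i))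

theorem abs_pdiff_le {n : ℕ} {L : NNReal} {u : (Fin n → ℝ) → ℝ} (hu : LipschitzWith L u)
    (i : Fin n) (x : Fin n → ℝ) : |pdiff i u x| ≤ L := by
  have h := norm_deriv_le_of_lipschitz (hu.comp (lipschitzWith_update x i)) (x₀ := x i)
  rwa [mul_one] at h

theorem abs_min_zero_le (a : ℝ) : |min 0 a| ≤ |a| := by
  simpa using abs_min_sub_min_le_max (0 : ℝ) a 0 0

theorem abs_abs_min_pdiff_le {n : ℕ} {L : NNReal} {u : (Fin n → ℝ) → ℝ} (hu : LipschitzWith L u)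
    (i : Fin n) (x : Fin n → ℝ) : |(|min 0 (pdiff i u x)|)| ≤ L := by
  rw [abs_abs]
  exact (abs_min_zero_le _).trans (abs_pdiff_le hu i x)

theorem stepDecrease_le {n : ℕ} {L : NNReal} {u : (Fin n → ℝ) → ℝ} (hu : LipschitzWith L u)
    {M : ℝ} (hM : ∀ x, |u x| ≤ M) (i : Fin n)
    (hconst : ∀ x t, 1 ≤ t → u (Function.update x i t) = u (Function.update x i 1)) {h : ℝ}
    (hh : 0 ≤ h) :
    stepDecrease i h u ≤ h * ∫ x, |min 0 (pdiff i u x)| ∂cubeMeasure n := by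
  have hD : Measurable fun x => |min 0 (pdiff i u x)| :=
    (measurable_const.min (measurable_pdiff hu.continuous i)).abs
  rw [← integral_const_mul]
  refine integral_cubeMeasure_mono_lines i
    (measurable_posPart_sub_shift i h hu.continuous.measurable) (hD.const_mul h)
    (fun x => abs_posPart_sub_le (hM _) (hM _)) (N := h * L) (fun x => ?_) fun x => ?_
  · rw [abs_mul, abs_of_nonneg hh]
    exact mul_le_mul_of_nonneg_left (abs_abs_min_pdiff_le hu i x) hh
  · have hline : LipschitzWith (L * 1) fun t => u (Function.update x i t) :=
      hu.comp (lipschitzWith_update x i)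
    have key := integral_posPart_sub_shift_le hline (fun t ht => hconst x t ht) hh
    rw [integral_const_mul]
    simpa only [pdiff, Function.update_self, Function.update_idem] using key

/-- **Directed `(L¹, ℓ¹)`-Poincaré inequality on the unit cube.**
For a Lipschitz function `f : [0,1]ⁿ → ℝ` with monotone rearrangement `f*`,
`E[|f − f*|] ≤ 2 E[‖∇⁻ f‖₁]` over the uniform (Lebesgue) measure on `[0,1]ⁿ`. -/
theorem directed_l1_poincare_unit_cube {n : ℕ} (K : NNReal) (f : (Fin n → ℝ) → ℝ)
    (hf : LipschitzOnWith K f (Set.Icc 0 1)) :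
    (∫ x in Set.Icc (0 : Fin n → ℝ) 1, |f x - monoRearr (fun _ => 1) f x|) ≤
      2 * ∫ x in Set.Icc (0 : Fin n → ℝ) 1, ∑ i, |min 0 (pdiff i f x)| := by
  obtain ⟨M, hM⟩ := isCompact_Icc.exists_bound_of_continuousOn hf.continuousOn
  set u : (Fin n → ℝ) → ℝ := f ∘ cubeClamp with hu
  have huM (x) : |u x| ≤ M := hM _ (cubeClamp_mem x)
  have huK : LipschitzWith K u := by
    rw [← lipschitzOnWith_univ]
    have := hf.comp (lipschitzWith_cubeClamp.lipschitzOnWith (s := Set.univ))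
      fun x _ => cubeClamp_mem x
    rwa [mul_one] at this
  have hfu : Set.EqOn f u (Set.univ.pi fun _ => Set.Ioc 0 1) := fun x hx => by
    rw [hu, Function.comp_apply, cubeClamp_of_mem]
    exact ⟨fun k => (hx k trivial).1.le, fun k => (hx k trivial).2⟩
  have hLip : LipschitzAlong (List.finRange n) M K u :=
    ⟨huK.continuous.measurable, huM, fun i _ x => by
      have := huK.comp (lipschitzWith_update x i)
      rwa [mul_one] at this⟩
  have hmain := (integral_abs_sub_foldl_cubeRearr_le (List.nodup_finRange n) hLip
    (c := fun i => ∫ x, |min 0 (pdiff i u x)| ∂cubeMeasure n) fun i _ h hh =>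
      stepDecrease_le huK huM i
        (fun x t ht => congrArg f (cubeClamp_update_of_one_le x i ht)) hh.le).2
  rw [restrict_Icc_eq_cubeMeasure]
  have hleft : ∫ x, |f x - monoRearr (fun _ => 1) f x| ∂cubeMeasure n =
      ∫ x, |u x - (List.finRange n).foldl (fun g i => cubeRearr i g) u x| ∂cubeMeasure n := by
    refine integral_congr_ae ?_
    filter_upwards [ae_cubeMeasure_mem_Ioo n] with x hx
    have hx' : x ∈ Set.univ.pi fun _ : Fin n => Set.Ioc (0 : ℝ) 1 :=
      fun k hk => Set.Ioo_subset_Ioc_self (hx k hk)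
    rw [monoRearr, hfu hx', eqOn_foldl_rearrDir _ hfu hx']
  have hright : ∫ x, ∑ i, |min 0 (pdiff i f x)| ∂cubeMeasure n =
      ∑ i, ∫ x, |min 0 (pdiff i u x)| ∂cubeMeasure n := by
    rw [← integral_finsetSum]
    · refine integral_congr_ae ?_
      filter_upwards [ae_cubeMeasure_mem_Ioo n] with x hx
      simp only [hu, pdiff_comp_cubeClamp f _ hx]
    · exact fun i _ => integrable_of_abs_le
        (measurable_const.min (measurable_pdiff huK.continuous i)).abs
        (abs_abs_min_pdiff_le huK i)
  have hsum : ((List.finRange n).map fun i => ∫ x, |min 0 (pdiff i u x)| ∂cubeMeasure n).sum =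
      ∑ i, ∫ x, |min 0 (pdiff i u x)| ∂cubeMeasure n := (Fin.sum_univ_def _).symm
  have hnonneg : 0 ≤ ∑ i, ∫ x, |min 0 (pdiff i u x)| ∂cubeMeasure n :=
    Finset.sum_nonneg fun i _ => integral_nonneg fun x => abs_nonneg _
  rw [hleft, hright]
  linarith
end

section
/- Let f : [0,1]^n → ℝ be Lipschitz continuous and let f* be its monotone rearrangement. Then E[|f − f*|] ≤ 2·d₁(f), where d₁(f) = inf over monotone g ∈ L¹([0,1]^n) of E[|f − g|], with expectations over the uniform (Lebesgue) measure on [0,1]^n. -/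
open MeasureTheory

open Set Filter Topology

lemma volume_levelSet (m : ℝ) (h : ℝ → ℝ) (c : ℝ) :
    volume (levelSet m h c) = volume.restrict (Ioc 0 m) {t | h t ≤ c} := by
  rw [Measure.restrict_congr_set Ioc_ae_eq_Icc, Measure.restrict_apply' measurableSet_Icc, inter_comm]
  rfl

/-- The sublevel sets of the rearrangement are initial segments of the same length as the
sublevel sets of the function. -/
lemma rearr1_le_iff {m M : ℝ} {h : ℝ → ℝ} (hm : AEMeasurable h (volume.restrict (Ioc 0 m)))
    (hb : ∀ t ∈ Ioc 0 m, |h t| ≤ M) {x : ℝ} (hx : x ∈ Ioc 0 m) (c : ℝ) :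
    rearr1 m h x ≤ c ↔ ENNReal.ofReal x ≤ volume.restrict (Ioc 0 m) {t | h t ≤ c} := by
  set μ := volume.restrict (Ioc 0 m) with hμ
  set S : Set ℝ := {c | ENNReal.ofReal x ≤ μ {t | h t ≤ c}} with hS
  have hpos : 0 < ENNReal.ofReal x := ENNReal.ofReal_pos.2 hx.1
  have hr : rearr1 m h x = sInf S := by
    unfold rearr1
    congr 1
    ext c
    simp only [mem_ofPred_eq, hS, volume_levelSet]
    refine ⟨fun H => H.2.2, fun H => ⟨?_, hx.1.le, H⟩⟩
    apply nonempty_of_measure_ne_zero (μ := volume)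
    rw [volume_levelSet]
    exact (hpos.trans_le H).ne'
  have hbdd : BddBelow S := by
    refine ⟨-M, fun c hc => ?_⟩
    have hne : μ {t | h t ≤ c} ≠ 0 := (hpos.trans_le hc).ne'
    rw [hμ, Measure.restrict_apply' measurableSet_Ioc] at hne
    obtain ⟨t, ht, ht'⟩ := nonempty_of_measure_ne_zero hne
    exact (abs_le.1 (hb t ht')).1.trans ht
  have hne : S.Nonempty := by
    refine ⟨M, ?_⟩
    have : {t | h t ≤ M} ∩ Ioc 0 m = Ioc 0 m :=
      inter_eq_right.2 fun t ht => (abs_le.1 (hb t ht)).2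
    simp only [hS, mem_ofPred_eq, hμ, Measure.restrict_apply' measurableSet_Ioc, this,
      Real.volume_Ioc, sub_zero]
    exact ENNReal.ofReal_le_ofReal hx.2
  have hup : ∀ {c d}, c ∈ S → c ≤ d → d ∈ S := fun hc hcd =>
    le_trans hc (measure_mono fun t ht => le_trans ht hcd)
  rw [hr]
  refine ⟨fun H => ?_, fun H => csInf_le hbdd H⟩
  obtain ⟨u, hu, huc, hut⟩ := exists_seq_strictAnti_tendsto c
  have hS' : ∀ k, u k ∈ S := fun k => by
    obtain ⟨d, hd, hdu⟩ := (csInf_lt_iff hbdd hne).1 (H.trans_lt (huc k))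
    exact hup hd hdu.le
  have hlim := tendsto_measure_iInter_atTop (μ := μ) (s := fun k => {t | h t ≤ u k})
    (fun k => nullMeasurableSet_le hm aemeasurable_const)
    (fun k l hkl t ht => le_trans ht (hu.antitone hkl)) ⟨0, measure_ne_top _ _⟩
  have hiInter : (⋂ k, {t | h t ≤ u k}) = {t | h t ≤ c} := by
    ext t
    simp only [mem_iInter, mem_ofPred_eq]
    exact ⟨fun ht => ge_of_tendsto' hut ht, fun ht k => ht.trans (huc k).le⟩
  rw [hiInter] at hlim
  exact ge_of_tendsto' hlim hS'

lemma abs_rearr1_le {m M : ℝ} {h : ℝ → ℝ} (hm : AEMeasurable h (volume.restrict (Ioc 0 m)))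
    (hb : ∀ t ∈ Ioc 0 m, |h t| ≤ M) {x : ℝ} (hx : x ∈ Ioc 0 m) : |rearr1 m h x| ≤ M := by
  rw [abs_le]
  constructor
  · have H := (rearr1_le_iff hm hb hx _).1 le_rfl
    have hne := ((ENNReal.ofReal_pos.2 hx.1).trans_le H).ne'
    rw [Measure.restrict_apply' measurableSet_Ioc] at hne
    obtain ⟨t, ht, ht'⟩ := nonempty_of_measure_ne_zero hne
    exact (abs_le.1 (hb t ht')).1.trans ht
  · have hM : {t | h t ≤ M} ∩ Ioc 0 m = Ioc 0 m :=
      inter_eq_right.2 fun t ht => (abs_le.1 (hb t ht)).2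
    rw [rearr1_le_iff hm hb hx, Measure.restrict_apply' measurableSet_Ioc, hM, Real.volume_Ioc,
      sub_zero]
    exact ENNReal.ofReal_le_ofReal hx.2

lemma rearr1_monotoneOn {m M : ℝ} {h : ℝ → ℝ}
    (hm : AEMeasurable h (volume.restrict (Ioc 0 m))) (hb : ∀ t ∈ Ioc 0 m, |h t| ≤ M) :
    MonotoneOn (rearr1 m h) (Ioc 0 m) := fun _ hx _ hy hxy =>
  (rearr1_le_iff hm hb hx _).2
    ((ENNReal.ofReal_le_ofReal hxy).trans ((rearr1_le_iff hm hb hy _).1 le_rfl))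

lemma measure_rearr1_le {m M : ℝ} {h : ℝ → ℝ}
    (hm : AEMeasurable h (volume.restrict (Ioc 0 m))) (hb : ∀ t ∈ Ioc 0 m, |h t| ≤ M) (c : ℝ) :
    volume.restrict (Ioc 0 m) {t | rearr1 m h t ≤ c} =
      volume.restrict (Ioc 0 m) {t | h t ≤ c} := by
  have hfin : volume.restrict (Ioc 0 m) {t | h t ≤ c} ≠ ⊤ := measure_ne_top _ _
  have hle : volume.restrict (Ioc 0 m) {t | h t ≤ c} ≤ ENNReal.ofReal m := by
    refine (measure_mono (subset_univ _)).trans ?_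
    simp
  have heq : {t | rearr1 m h t ≤ c} ∩ Ioc 0 m =
      Ioc 0 (volume.restrict (Ioc 0 m) {t | h t ≤ c}).toReal := by
    ext t
    simp only [mem_inter_iff, mem_ofPred_eq]
    constructor
    · rintro ⟨h1, h2⟩
      exact ⟨h2.1, (ENNReal.ofReal_le_iff_le_toReal hfin).1 ((rearr1_le_iff hm hb h2 c).1 h1)⟩
    · rintro ⟨h1, h2⟩
      have h3 : ENNReal.ofReal t ≤ _ := (ENNReal.ofReal_le_iff_le_toReal hfin).2 h2
      have h4 : t ∈ Ioc 0 m := by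
        refine ⟨h1, ?_⟩
        have h5 := h3.trans hle
        by_contra! h6
        exact absurd h5 (not_le.2 ((ENNReal.ofReal_lt_ofReal_iff h1).2 h6))
      exact ⟨(rearr1_le_iff hm hb h4 c).2 h3, h4⟩
  rw [Measure.restrict_apply' measurableSet_Ioc, heq, Real.volume_Ioc, sub_zero,
    ENNReal.ofReal_toReal hfin]

/-- Layer-cake formula for the `L¹` distance. -/
lemma lintegral_abs_sub_eq {α : Type*} [MeasurableSpace α] {μ : Measure α} [SFinite μ]
    {u v : α → ℝ} (hu : AEMeasurable u μ) (hv : AEMeasurable v μ) :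
    ∫⁻ x, ENNReal.ofReal |u x - v x| ∂μ = ∫⁻ c : ℝ, μ {x | ¬(u x ≤ c ↔ v x ≤ c)} := by
  wlog H : Measurable u ∧ Measurable v generalizing u v
  · have h1 := this hu.measurable_mk.aemeasurable hv.measurable_mk.aemeasurable
      ⟨hu.measurable_mk, hv.measurable_mk⟩
    refine Eq.trans (lintegral_congr_ae ?_) (h1.trans ?_)
    · filter_upwards [hu.ae_eq_mk, hv.ae_eq_mk] with x hx hy
      rw [← hx, ← hy]
    · refine lintegral_congr fun c => measure_congr ?_
      filter_upwards [hu.ae_eq_mk, hv.ae_eq_mk] with x hx hy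
      change (¬(_ ↔ _)) = (¬(_ ↔ _))
      rw [← hx, ← hy]
  obtain ⟨hu, hv⟩ := H
  have hS : MeasurableSet {p : α × ℝ | ¬(u p.1 ≤ p.2 ↔ v p.1 ≤ p.2)} := by
    apply MeasurableSet.compl
    exact MeasurableSet.iff (measurableSet_le (hu.comp measurable_fst) measurable_snd)
      (measurableSet_le (hv.comp measurable_fst) measurable_snd)
  have h1 := Measure.prod_apply (μ := μ) (ν := (volume : Measure ℝ)) hS
  rw [Measure.prod_apply_symm hS] at h1
  refine Eq.trans ?_ h1.symm
  refine lintegral_congr fun x => ?_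
  have : Prod.mk x ⁻¹' {p : α × ℝ | ¬(u p.1 ≤ p.2 ↔ v p.1 ≤ p.2)} =
      Ico (min (u x) (v x)) (max (u x) (v x)) := by
    ext c
    simp only [mem_preimage, mem_ofPred_eq, mem_Ico, min_le_iff, lt_max_iff]
    rw [← not_le, ← not_le]
    tauto
  rw [this, Real.volume_Ico, max_sub_min_eq_abs, abs_sub_comm]

/-- Among functions with a sublevel set of given measure, a monotone one is closest to any
other monotone function at that level. -/
lemma measure_not_iff_le {s : Set ℝ} (hs : MeasurableSet s) {μ : Measure ℝ}
    [IsFiniteMeasure (μ.restrict s)] {u v h : ℝ → ℝ} (hu : MonotoneOn u s) (hv : MonotoneOn v s)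
    {c : ℝ} (huh : μ.restrict s {t | u t ≤ c} = μ.restrict s {t | h t ≤ c}) :
    μ.restrict s {t | ¬(u t ≤ c ↔ v t ≤ c)} ≤ μ.restrict s {t | ¬(h t ≤ c ↔ v t ≤ c)} := by
  have hum := aemeasurable_restrict_of_monotoneOn (μ := μ) hs hu
  have hvm := aemeasurable_restrict_of_monotoneOn (μ := μ) hs hv
  have key : ∀ {A B : ℝ → ℝ}, AEMeasurable A (μ.restrict s) →
      (∀ t ∈ s, A t ≤ c → B t ≤ c) →
      μ.restrict s {t | ¬(A t ≤ c ↔ B t ≤ c)} =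
        μ.restrict s {t | B t ≤ c} - μ.restrict s {t | A t ≤ c} := by
    intro A B hA hAB
    have hae : ∀ᵐ t ∂μ.restrict s, A t ≤ c → B t ≤ c :=
      (ae_restrict_iff' hs).2 (.of_forall hAB)
    have h1 : ({t | ¬(A t ≤ c ↔ B t ≤ c)} : Set ℝ) =ᵐ[μ.restrict s]
        ({t | A t ≤ c ∨ B t ≤ c} \ {t | A t ≤ c} : Set ℝ) := by
      filter_upwards [hae] with t ht
      change (¬_) = ((_ ∨ _) ∧ ¬ _)
      apply propext
      tauto
    have h2 : ({t | A t ≤ c ∨ B t ≤ c} : Set ℝ) =ᵐ[μ.restrict s] {t | B t ≤ c} := by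
      filter_upwards [hae] with t ht
      change (_ ∨ _) = _
      apply propext
      change _ ↔ B t ≤ c
      tauto
    rw [measure_congr h1, measure_sdiff (show {t | A t ≤ c} ⊆ {t | A t ≤ c ∨ B t ≤ c} from fun _ ht => Or.inl ht)
      (nullMeasurableSet_le hA aemeasurable_const) (measure_ne_top _ _), measure_congr h2]
  by_cases H : ∀ t ∈ s, u t ≤ c → v t ≤ c
  · rw [key hum H, huh]
    refine le_measure_sdiff.trans (measure_mono fun t ht => ?_)
    have h1 : v t ≤ c := ht.1
    have h2 : ¬ h t ≤ c := ht.2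
    change ¬ _
    tauto
  · have H' : ∀ t ∈ s, v t ≤ c → u t ≤ c := by
      push Not at H
      obtain ⟨p, hp, hup, hvp⟩ := H
      intro q hq hvq
      rcases le_total p q with hpq | hqp
      · exact absurd ((hv hp hq hpq).trans hvq) (not_le.2 hvp)
      · exact (hu hq hp hqp).trans hup
    simp only [iff_comm (b := v _ ≤ c)]
    rw [key hvm H', huh]
    refine le_measure_sdiff.trans (measure_mono fun t ht => ?_)
    have h1 : h t ≤ c := ht.1
    have h2 : ¬ v t ≤ c := ht.2
    change ¬ _
    tauto

/-- Rearranging does not increase the `L¹` distance to a monotone function. -/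
lemma lintegral_abs_rearr1_sub_le {m M : ℝ} {h g : ℝ → ℝ}
    (hm : AEMeasurable h (volume.restrict (Ioc 0 m))) (hb : ∀ t ∈ Ioc 0 m, |h t| ≤ M)
    (hg : MonotoneOn g (Ioc 0 m)) :
    ∫⁻ t in Ioc 0 m, ENNReal.ofReal |rearr1 m h t - g t| ≤
      ∫⁻ t in Ioc 0 m, ENNReal.ofReal |h t - g t| := by
  have hmono := rearr1_monotoneOn hm hb
  have hgm := aemeasurable_restrict_of_monotoneOn (μ := volume) measurableSet_Ioc hg
  rw [lintegral_abs_sub_eq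
    (aemeasurable_restrict_of_monotoneOn (μ := volume) measurableSet_Ioc hmono) hgm,
    lintegral_abs_sub_eq hm hgm]
  exact lintegral_mono fun c =>
    measure_not_iff_le measurableSet_Ioc hmono hg (measure_rearr1_le hm hb c)

/-- Integrals over a product compare if they compare along almost all lines in direction `i`. -/
lemma lintegral_pi_le_of_lines {k : ℕ} (μ : Fin (k + 1) → Measure ℝ) [∀ j, SigmaFinite (μ j)]
    (i : Fin (k + 1)) {F G : (Fin (k + 1) → ℝ) → ENNReal} (hG : AEMeasurable G (Measure.pi μ))
    (hFG : ∀ᵐ y ∂Measure.pi fun j => μ (i.succAbove j),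
      ∫⁻ t, F (i.insertNth t y) ∂μ i ≤ ∫⁻ t, G (i.insertNth t y) ∂μ i) :
    ∫⁻ x, F x ∂Measure.pi μ ≤ ∫⁻ x, G x ∂Measure.pi μ := by
  let e := (MeasurableEquiv.prodComm.trans (MeasurableEquiv.piFinSuccAbove (fun _ => ℝ) i).symm)
  have he : MeasurePreserving e
      ((Measure.pi fun j => μ (i.succAbove j)).prod (μ i)) (Measure.pi μ) :=
    ((measurePreserving_piFinSuccAbove μ i).symm _).comp Measure.measurePreserving_swap
  rw [← he.lintegral_comp_emb e.measurableEmbedding, ← he.lintegral_comp_emb e.measurableEmbedding,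
    lintegral_prod (fun z => G (e z)) (hG.comp_quasiMeasurePreserving he.quasiMeasurePreserving)]
  exact (lintegral_prod_le _).trans (lintegral_mono_ae hFG)

section Box

variable {n : ℕ} {a : Fin n → ℝ} {f g : (Fin n → ℝ) → ℝ} {M : ℝ}

/-- The half-open box `(0,a₁] × ⋯ × (0,aₙ]`. -/
def hbox (a : Fin n → ℝ) : Set (Fin n → ℝ) := univ.pi fun i => Ioc 0 (a i)

lemma measurableSet_hbox : MeasurableSet (hbox a) :=
  MeasurableSet.univ_pi fun _ => measurableSet_Ioc

lemma update_mem_hbox {i : Fin n} {x : Fin n → ℝ} (hx : ∀ j ≠ i, x j ∈ Ioc 0 (a j)) {t : ℝ}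
    (ht : t ∈ Ioc 0 (a i)) : Function.update x i t ∈ hbox a := by
  intro j _
  rcases eq_or_ne j i with rfl | hj
  · simpa using ht
  · simpa [hj] using hx j hj

lemma aemeasurable_line (hf : Measurable ((hbox a).domRestrict f)) {i : Fin n} {x : Fin n → ℝ}
    (hx : ∀ j ≠ i, x j ∈ Ioc 0 (a j)) :
    AEMeasurable (fun t => f (Function.update x i t)) (volume.restrict (Ioc 0 (a i))) := by
  refine aemeasurable_restrict_of_measurable_subtype measurableSet_Ioc ?_
  have h1 : Measurable fun t : Ioc 0 (a i) =>
      (⟨Function.update x i t, update_mem_hbox hx t.2⟩ : hbox a) :=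
    ((measurable_update x).comp measurable_subtype_coe).subtype_mk
  exact hf.comp h1

lemma rearrDir_abs_le (hf : Measurable ((hbox a).domRestrict f)) (hb : ∀ x ∈ hbox a, |f x| ≤ M)
    (i : Fin n) : ∀ x ∈ hbox a, |rearrDir a i f x| ≤ M := fun _ hx =>
  abs_rearr1_le (aemeasurable_line hf fun j _ => hx j trivial)
    (fun _ ht => hb _ (update_mem_hbox (fun j _ => hx j trivial) ht)) (hx i trivial)

lemma rearrDir_measurable (hf : Measurable ((hbox a).domRestrict f))
    (hb : ∀ x ∈ hbox a, |f x| ≤ M) (i : Fin n) :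
    Measurable ((hbox a).domRestrict (rearrDir a i f)) := by
  refine measurable_of_Iic fun c => ?_
  let u : hbox a × Ioc 0 (a i) → hbox a := fun p =>
    ⟨Function.update p.1 i p.2, update_mem_hbox (fun j _ => p.1.2 j trivial) p.2.2⟩
  have hu : Measurable u := by
    refine Measurable.subtype_mk ?_
    exact measurable_update'.comp
      ((measurable_subtype_coe.comp measurable_fst).prodMk
        (measurable_subtype_coe.comp measurable_snd))
  have hS : MeasurableSet {p | (hbox a).domRestrict f (u p) ≤ c} :=
    measurableSet_le (hf.comp hu) measurable_const
  let ν : Measure (Ioc 0 (a i)) := Measure.comap Subtype.val (volume.restrict (Ioc 0 (a i)))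
  have hmeas := measurable_measure_prodMk_left (ν := ν) hS
  have heq : (hbox a).domRestrict (rearrDir a i f) ⁻¹' Iic c =
      {x | ENNReal.ofReal (x.1 i) ≤
        ν (Prod.mk x ⁻¹' {p | (hbox a).domRestrict f (u p) ≤ c})} := by
    ext x
    change rearr1 _ _ _ ≤ c ↔ _
    rw [rearr1_le_iff (aemeasurable_line hf fun j _ => x.2 j trivial)
      (fun _ ht => hb _ (update_mem_hbox (fun j _ => x.2 j trivial) ht)) (x.2 i trivial),
      mem_ofPred_eq, comap_subtype_coe_apply measurableSet_Ioc,
      Measure.restrict_apply' measurableSet_Ioc, Measure.restrict_apply' measurableSet_Ioc]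
    have : {t | f (Function.update x.1 i t) ≤ c} ∩ Ioc 0 (a i) =
        Subtype.val '' (Prod.mk x ⁻¹' {p | (hbox a).domRestrict f (u p) ≤ c}) ∩ Ioc 0 (a i) := by
      ext t
      simp +contextual [u, domRestrict]
    rw [this]
  rw [heq]
  exact measurableSet_le
    (((measurable_pi_apply i).comp measurable_subtype_coe).ennreal_ofReal) hmeas

lemma volume_restrict_hbox (a : Fin n → ℝ) :
    volume.restrict (hbox a) = Measure.pi fun i => volume.restrict (Ioc 0 (a i)) := by
  rw [volume_pi]
  exact Measure.restrict_pi_pi _ _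

lemma lintegral_abs_rearrDir_sub_le (hf : Measurable ((hbox a).domRestrict f))
    (hb : ∀ x ∈ hbox a, |f x| ≤ M) (hg : MonotoneOn g (hbox a))
    (hgm : AEMeasurable g (volume.restrict (hbox a))) (i : Fin n) :
    ∫⁻ x in hbox a, ENNReal.ofReal |rearrDir a i f x - g x| ≤
      ∫⁻ x in hbox a, ENNReal.ofReal |f x - g x| := by
  have hfm : AEMeasurable f (volume.restrict (hbox a)) :=
    aemeasurable_restrict_of_measurable_subtype measurableSet_hbox hf
  have hG : AEMeasurable (fun x => ENNReal.ofReal |f x - g x|) (volume.restrict (hbox a)) :=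
    (continuous_abs.measurable.comp_aemeasurable (hfm.sub hgm)).ennreal_ofReal
  rw [volume_restrict_hbox] at hG ⊢
  obtain _ | k := n
  · exact i.elim0
  refine lintegral_pi_le_of_lines _ i hG ?_
  rw [← volume_restrict_hbox fun j => a (i.succAbove j)]
  refine (ae_restrict_iff' measurableSet_hbox).2 (.of_forall fun y hy => ?_)
  have hx : ∀ j ≠ i, i.insertNth (α := fun _ => ℝ) 0 y j ∈ Ioc 0 (a j) := by
    intro j hj
    obtain ⟨l, rfl⟩ := Fin.exists_succAbove_eq hj
    simpa using hy l trivial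
  have hgl : MonotoneOn (fun t => g (Function.update (i.insertNth (α := fun _ => ℝ) 0 y) i t))
      (Ioc 0 (a i)) := fun s hs t ht hst =>
    hg (update_mem_hbox hx hs) (update_mem_hbox hx ht) (Function.update_mono hst)
  have := lintegral_abs_rearr1_sub_le (aemeasurable_line hf hx)
    (fun t ht => hb _ (update_mem_hbox hx ht)) hgl
  simpa [rearrDir, Fin.update_insertNth] using this

lemma foldl_rearrDir (l : List (Fin n)) (hf : Measurable ((hbox a).domRestrict f))
    (hb : ∀ x ∈ hbox a, |f x| ≤ M) :
    Measurable ((hbox a).domRestrict (l.foldl (fun g i => rearrDir a i g) f)) ∧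
    (∀ x ∈ hbox a, |l.foldl (fun g i => rearrDir a i g) f x| ≤ M) ∧
    ∀ g, MonotoneOn g (hbox a) → AEMeasurable g (volume.restrict (hbox a)) →
      ∫⁻ x in hbox a, ENNReal.ofReal |l.foldl (fun g i => rearrDir a i g) f x - g x| ≤
        ∫⁻ x in hbox a, ENNReal.ofReal |f x - g x| := by
  induction l generalizing f with
  | nil => exact ⟨hf, hb, fun g _ _ => le_rfl⟩
  | cons i l ih =>
    obtain ⟨h1, h2, h3⟩ := ih (rearrDir_measurable hf hb i) (rearrDir_abs_le hf hb i)
    exact ⟨h1, h2, fun g hg hgm =>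
      (h3 g hg hgm).trans (lintegral_abs_rearrDir_sub_le hf hb hg hgm i)⟩

lemma integrableOn_hbox (hf : Measurable ((hbox a).domRestrict f)) (hb : ∀ x ∈ hbox a, |f x| ≤ M) :
    IntegrableOn f (hbox a) := by
  have hfin : IsFiniteMeasure (volume.restrict (hbox a)) := by
    rw [volume_restrict_hbox]
    infer_instance
  refine Integrable.of_bound (C := M)
    (aemeasurable_restrict_of_measurable_subtype measurableSet_hbox hf).aestronglyMeasurable ?_
  exact (ae_restrict_iff' measurableSet_hbox).2 (.of_forall hb)

end Box

/-- **The monotone rearrangement is essentially optimal on the unit cube:**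
for Lipschitz `f : [0,1]ⁿ → ℝ`, `E[|f − f*|] ≤ 2 d₁(f)`, where `d₁(f)` is the `L¹`
distance from `f` to the monotone functions in `L¹([0,1]ⁿ)`. -/
theorem rearrangement_optimal_unit_cube {n : ℕ} (K : NNReal) (f : (Fin n → ℝ) → ℝ)
    (hf : LipschitzOnWith K f (Set.Icc 0 1)) :
    (∫ x in Set.Icc (0 : Fin n → ℝ) 1, |f x - monoRearr (fun _ => 1) f x|) ≤
      2 * sInf {d : ℝ | ∃ g : (Fin n → ℝ) → ℝ, MonotoneOn g (Set.Icc 0 1) ∧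
        IntegrableOn g (Set.Icc 0 1) ∧
        d = ∫ x in Set.Icc (0 : Fin n → ℝ) 1, |f x - g x|} := by
  have hsub : hbox (fun _ : Fin n => (1 : ℝ)) ⊆ Icc 0 1 := fun x hx =>
    ⟨fun i => (hx i trivial).1.le, fun i => (hx i trivial).2⟩
  have hae : volume.restrict (Icc (0 : Fin n → ℝ) 1) = volume.restrict (hbox fun _ => 1) := by
    rw [volume_pi]
    exact Measure.restrict_congr_set Measure.univ_pi_Ioc_ae_eq_Icc.symm
  obtain ⟨M, hM⟩ := isCompact_Icc.exists_bound_of_continuousOn hf.continuousOn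
  have hfm : Measurable ((hbox fun _ => 1).domRestrict f) :=
    (hf.continuousOn.mono hsub).domRestrict.measurable
  have hb : ∀ x ∈ hbox (fun _ : Fin n => (1 : ℝ)), |f x| ≤ M := fun x hx => hM x (hsub hx)
  obtain ⟨hrm, hrb, hr⟩ := foldl_rearrDir (List.finRange n) hfm hb
  have hfi := integrableOn_hbox hfm hb
  have hri : IntegrableOn (monoRearr (fun _ => 1) f) (hbox fun _ => 1) :=
    integrableOn_hbox hrm hrb
  rw [mul_comm, ← div_le_iff₀ two_pos]
  refine le_csInf ⟨_, fun _ => 0, monotoneOn_const, integrableOn_zero, rfl⟩ ?_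
  rintro _ ⟨g, hg, hgi, rfl⟩
  unfold IntegrableOn at hgi hfi hri
  rw [hae] at hgi ⊢
  have hfg : Integrable (fun x => |f x - g x|) (volume.restrict (hbox fun _ => 1)) :=
    (hfi.sub hgi).abs
  have hrg : Integrable (fun x => |monoRearr (fun _ => 1) f x - g x|)
      (volume.restrict (hbox fun _ => 1)) := (hri.sub hgi).abs
  have hdist : (∫ x in hbox fun _ => 1, |monoRearr (fun _ => 1) f x - g x|) ≤
      ∫ x in hbox fun _ => 1, |f x - g x| := by
    rw [← ENNReal.ofReal_le_ofReal_iff (integral_nonneg fun _ => abs_nonneg _),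
      ofReal_integral_eq_lintegral_ofReal hrg (.of_forall fun _ => abs_nonneg _),
      ofReal_integral_eq_lintegral_ofReal hfg (.of_forall fun _ => abs_nonneg _)]
    exact hr g (hg.mono hsub) hgi.aemeasurable
  have htri : (∫ x in hbox fun _ => 1, |f x - monoRearr (fun _ => 1) f x|) ≤
      (∫ x in hbox fun _ => 1, |f x - g x|) +
        ∫ x in hbox fun _ => 1, |monoRearr (fun _ => 1) f x - g x| := by
    rw [← integral_add hfg hrg]
    refine integral_mono (hfi.sub hri).abs (hfg.add hrg) fun x => ?_
    change |f x - monoRearr _ f x| ≤ |f x - g x| + |monoRearr _ f x - g x|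
    rw [abs_sub_comm (monoRearr _ _ _)]
    exact abs_sub_le _ _ _
  linarith
end

section
/- Let f : [m]^n → ℝ and let f* = R_n R_{n-1} ⋯ R_1 f be its monotone rearrangement, where R_i sorts f along every line in direction i. Then E[|f − f*|] ≤ 2m · E[‖∇⁻f‖₁], where expectations are over the uniform measure on [m]^n. -/
/-- The sorted (non-decreasing) rearrangement of a tuple of reals. -/
noncomputable def sortTuple {m : ℕ} (f : Fin m → ℝ) : Fin m → ℝ := f ∘ Tuple.sort f

/-- The rearrangement (sorting) operator in direction `i` on the hypergrid `[m]ⁿ`: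
on every line in direction `i`, it is the non-decreasing sorting of the restriction of
`f` to that line. -/
noncomputable def sortDir {m n : ℕ} (i : Fin n) (f : (Fin n → Fin m) → ℝ) :
    (Fin n → Fin m) → ℝ :=
  fun x => sortTuple (fun t => f (Function.update x i t)) (x i)

/-- The monotone rearrangement `f* = Rₙ Rₙ₋₁ ⋯ R₁ f` on the hypergrid. -/
noncomputable def gridRearr {m n : ℕ} (f : (Fin n → Fin m) → ℝ) : (Fin n → Fin m) → ℝ :=
  (List.finRange n).foldl (fun g i => sortDir i g) f

/-- The discrete partial derivative `∂ᵢ f(x) = f(x + eᵢ) − f(x)` if `xᵢ < m`, and `0`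
if `xᵢ = m`. -/
noncomputable def dPartial {m n : ℕ} (i : Fin n) (f : (Fin n → Fin m) → ℝ)
    (x : Fin n → Fin m) : ℝ :=
  if h : (x i : ℕ) + 1 < m then f (Function.update x i ⟨(x i : ℕ) + 1, h⟩) - f x else 0

theorem sum_sortTuple {m : ℕ} (a : Fin m → ℝ) : ∑ t, sortTuple a t = ∑ t, a t :=
  Equiv.sum_comp (Tuple.sort a) a

theorem sortTuple_of_monotone {m : ℕ} {a : Fin m → ℝ} (ha : Monotone a) : sortTuple a = a := by
  rw [sortTuple, Tuple.sort_eq_refl_iff_monotone.2 ha, Equiv.coe_refl, Function.comp_id]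

theorem sortTuple_mono {m : ℕ} {a b : Fin m → ℝ} (hab : ∀ t, a t ≤ b t) (k : Fin m) :
    sortTuple a k ≤ sortTuple b k := by
  obtain ⟨j, hjk, hj⟩ : ∃ j ≤ k, k ≤ (Tuple.sort a).symm (Tuple.sort b j) := by
    by_contra! h
    have hcard : (Finset.Iic k).card ≤ (Finset.Iio k).card :=
      Finset.card_le_card_of_injOn (fun j => (Tuple.sort a).symm (Tuple.sort b j))
        (fun j hj => by simpa using h j (by simpa using hj))
        (((Tuple.sort a).symm.injective.comp (Tuple.sort b).injective).injOn)
    simp at hcard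
  calc sortTuple a k ≤ sortTuple a ((Tuple.sort a).symm (Tuple.sort b j)) :=
        Tuple.monotone_sort a hj
    _ = a (Tuple.sort b j) := by simp [sortTuple]
    _ ≤ sortTuple b j := hab _
    _ ≤ sortTuple b k := Tuple.monotone_sort b hjk

/-- Sorting two tuples does not increase the total amount by which the first exceeds the second. -/
theorem sum_abs_min_sortTuple_sub_le {m : ℕ} (a b : Fin m → ℝ) :
    ∑ t, |min 0 (sortTuple b t - sortTuple a t)| ≤ ∑ t, |min 0 (b t - a t)| := by
  have key : ∀ x y : ℝ, |min 0 (y - x)| = max x y - y := fun x y => by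
    rw [abs_of_nonpos (min_le_left _ _)]
    rcases le_total x y with h | h
    · rw [max_eq_right h, min_eq_left (by linarith)]; ring
    · rw [max_eq_left h, min_eq_right (by linarith)]; ring
  calc ∑ t, |min 0 (sortTuple b t - sortTuple a t)|
      ≤ ∑ t, (sortTuple (fun s => max (a s) (b s)) t - sortTuple b t) := by
        refine Finset.sum_le_sum fun t _ => ?_
        rw [key]
        exact sub_le_sub_right (max_le (sortTuple_mono (fun _ => le_max_left _ _) t)
          (sortTuple_mono (fun _ => le_max_right _ _) t)) _
    _ = ∑ t, |min 0 (b t - a t)| := by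
        simp only [key, Finset.sum_sub_distrib, sum_sortTuple]

/-- The `ℓ¹` distance from a tuple to its sorting is at most twice that to any monotone
majorant. -/
theorem sum_abs_sub_sortTuple_le {m : ℕ} {a g : Fin m → ℝ} (hg : Monotone g)
    (hag : ∀ t, a t ≤ g t) : ∑ t, |a t - sortTuple a t| ≤ 2 * ∑ t, (g t - a t) := by
  have hs : ∀ t, sortTuple a t ≤ g t := fun t =>
    (sortTuple_mono hag t).trans_eq (congrFun (sortTuple_of_monotone hg) t)
  calc ∑ t, |a t - sortTuple a t| ≤ ∑ t, ((g t - a t) + (g t - sortTuple a t)) :=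
        Finset.sum_le_sum fun t _ => abs_le.2
          ⟨by linarith [hag t, hs t], by linarith [hag t, hs t]⟩
    _ = 2 * ∑ t, (g t - a t) := by
        simp only [Finset.sum_add_distrib, Finset.sum_sub_distrib, sum_sortTuple]; ring

/-- The one-dimensional directed Poincaré inequality. -/
theorem sum_abs_sub_sortTuple_le_sum_decrease {m : ℕ} (a : Fin m → ℝ) :
    ∑ t, |a t - sortTuple a t| ≤
      2 * m * ∑ t : Fin m, |min 0 (if h : (t : ℕ) + 1 < m then a ⟨t + 1, h⟩ - a t else 0)| := by
  set d : Fin m → ℝ :=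
    fun t => |min 0 (if h : (t : ℕ) + 1 < m then a ⟨t + 1, h⟩ - a t else 0)| with hd
  have hd0 : ∀ t, 0 ≤ d t := fun t => abs_nonneg _
  have hmono : Monotone fun t => a t + ∑ s ∈ Finset.Iio t, d s := by
    cases m with
    | zero => exact fun t => t.elim0
    | succ m =>
      refine Fin.monotone_iff_le_succ.2 fun t => ?_
      have hI : Finset.Iio t.succ = insert t.castSucc (Finset.Iio t.castSucc) := by
        ext s
        simp only [Finset.mem_Iio, Finset.mem_insert, Fin.lt_def, Fin.ext_iff, Fin.val_succ,
          Fin.val_castSucc]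
        omega
      have hdt : a t.castSucc - a t.succ ≤ d t.castSucc := by
        have h : ((t.castSucc : Fin (m + 1)) : ℕ) + 1 < m + 1 := by simp
        have hd' : d t.castSucc = |min 0 (a t.succ - a t.castSucc)| := by
          simp only [hd, dif_pos h]; rfl
        rw [hd', abs_of_nonpos (min_le_left _ _)]
        linarith [min_le_right 0 (a t.succ - a t.castSucc)]
      simp only [hI, Finset.sum_insert (Finset.notMem_Iio_self)]
      linarith
  calc ∑ t, |a t - sortTuple a t| ≤ 2 * ∑ t, ((a t + ∑ s ∈ Finset.Iio t, d s) - a t) :=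
        sum_abs_sub_sortTuple_le hmono fun t =>
          le_add_of_nonneg_right (Finset.sum_nonneg fun s _ => hd0 s)
    _ ≤ 2 * ∑ _t : Fin m, ∑ s, d s := by
        gcongr with t
        rw [add_sub_cancel_left]
        exact Finset.sum_le_sum_of_subset_of_nonneg (Finset.subset_univ _) fun s _ _ => hd0 s
    _ = 2 * m * ∑ t, d t := by simp [mul_assoc]

theorem sum_sum_update {ι α M : Type*} [Fintype ι] [DecidableEq ι] [Fintype α]
    [AddCommMonoid M] (i : ι) (F : (ι → α) → M) :
    ∑ x : ι → α, ∑ t, F (Function.update x i t) = Fintype.card α • ∑ x, F x := by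
  have hinv : Function.Involutive
      fun p : (ι → α) × α => (Function.update p.1 i p.2, p.1 i) := fun p => by simp
  calc ∑ x : ι → α, ∑ t, F (Function.update x i t)
      = ∑ p : (ι → α) × α, F (Function.update p.1 i p.2) :=
        (Fintype.sum_prod_type fun p : (ι → α) × α => F (Function.update p.1 i p.2)).symm
    _ = ∑ p : (ι → α) × α, F p.1 := Equiv.sum_comp hinv.toPerm fun p => F p.1
    _ = Fintype.card α • ∑ x, F x := by
        simp [Fintype.sum_prod_type, Finset.smul_sum]

/-- Comparing sums over a product of finite types line by line. -/
theorem sum_le_sum_of_lines {ι α : Type*} [Fintype ι] [DecidableEq ι] [Fintype α] (i : ι)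
    {F G : (ι → α) → ℝ}
    (h : ∀ x, ∑ t, F (Function.update x i t) ≤ ∑ t, G (Function.update x i t)) :
    ∑ x, F x ≤ ∑ x, G x := by
  rcases isEmpty_or_nonempty α with hα | hα
  · have : IsEmpty (ι → α) := ⟨fun x => hα.false (x i)⟩
    simp
  · have hsum := Finset.sum_le_sum fun x (_ : x ∈ Finset.univ) => h x
    rw [sum_sum_update, sum_sum_update, nsmul_eq_mul, nsmul_eq_mul] at hsum
    exact le_of_mul_le_mul_left hsum (by exact_mod_cast Fintype.card_pos)

theorem sortDir_update {m n : ℕ} (i : Fin n) (f : (Fin n → Fin m) → ℝ) (x : Fin n → Fin m)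
    (t : Fin m) :
    sortDir i f (Function.update x i t) =
      sortTuple (fun s => f (Function.update x i s)) t := by
  simp [sortDir]

theorem sum_abs_sub_sortDir_le {m n : ℕ} (i : Fin n) (f : (Fin n → Fin m) → ℝ) :
    ∑ x, |f x - sortDir i f x| ≤ 2 * m * ∑ x, |min 0 (dPartial i f x)| := by
  rw [Finset.mul_sum]
  refine sum_le_sum_of_lines i fun x => ?_
  simpa [sortDir_update, dPartial, Finset.mul_sum] using
    sum_abs_sub_sortTuple_le_sum_decrease fun s => f (Function.update x i s)

theorem sum_abs_min_dPartial_sortDir_le {m n : ℕ} {i j : Fin n} (hij : j ≠ i)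
    (f : (Fin n → Fin m) → ℝ) :
    ∑ x, |min 0 (dPartial j (sortDir i f) x)| ≤ ∑ x, |min 0 (dPartial j f x)| := by
  refine sum_le_sum_of_lines i fun x => ?_
  by_cases h : (x j : ℕ) + 1 < m
  · simpa [dPartial, hij, h, Function.update_comm hij.symm, sortDir_update] using
      sum_abs_min_sortTuple_sub_le (fun s => f (Function.update x i s))
        (fun s => f (Function.update (Function.update x j ⟨x j + 1, h⟩) i s))
  · simp [dPartial, hij, h]

theorem sum_abs_sub_foldl_sortDir_le {m n : ℕ} (l : List (Fin n)) (hl : l.Nodup)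
    (f : (Fin n → Fin m) → ℝ) :
    ∑ x, |f x - l.foldl (fun g i => sortDir i g) f x| ≤
      2 * m * (l.map fun i => ∑ x, |min 0 (dPartial i f x)|).sum := by
  induction l generalizing f with
  | nil => simp
  | cons i l ih =>
    rw [List.nodup_cons] at hl
    rw [List.map_cons, List.sum_cons, List.foldl_cons, mul_add]
    calc ∑ x, |f x - l.foldl (fun g i => sortDir i g) (sortDir i f) x|
        ≤ ∑ x, (|f x - sortDir i f x| +
            |sortDir i f x - l.foldl (fun g i => sortDir i g) (sortDir i f) x|) :=
          Finset.sum_le_sum fun x _ => abs_sub_le _ _ _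
      _ ≤ _ := by
          rw [Finset.sum_add_distrib]
          refine add_le_add (sum_abs_sub_sortDir_le i f) ((ih hl.2 _).trans ?_)
          gcongr 2 * (m : ℝ) * ?_
          exact List.sum_le_sum fun j hj =>
            sum_abs_min_dPartial_sortDir_le (ne_of_mem_of_not_mem hj hl.1) f

/-- **Directed `(L¹, ℓ¹)`-Poincaré inequality on the hypergrid.**
For `f : [m]ⁿ → ℝ` with monotone rearrangement `f*`,
`E[|f − f*|] ≤ 2 m E[‖∇⁻ f‖₁]` over the uniform measure on `[m]ⁿ`. -/
theorem directed_l1_poincare_hypergrid {m n : ℕ} (f : (Fin n → Fin m) → ℝ) :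
    (1 / (m ^ n : ℝ)) * ∑ x, |f x - gridRearr f x| ≤
      2 * m * ((1 / (m ^ n : ℝ)) * ∑ x, ∑ i, |min 0 (dPartial i f x)|) := by
  have h := sum_abs_sub_foldl_sortDir_le _ (List.nodup_finRange n) f
  rw [← List.ofFn_eq_map, List.sum_ofFn, Finset.sum_comm] at h
  calc _ ≤ (1 / (m ^ n : ℝ)) * (2 * m * ∑ x, ∑ i, |min 0 (dPartial i f x)|) :=
        mul_le_mul_of_nonneg_left h (by positivity)
    _ = _ := by ring
end

section
/- Let m > 0 and let f : [0,m] → ℝ be absolutely continuous, with monotone rearrangement f*. Then ∫₀^m |f − f*| dν ≤ 2m · ∫₀^m |∂⁻f| dν, where ν is the Lebesgue measure. -/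
open MeasureTheory

/-- A primitive of an integrable function decreases between two points by at most the total mass
of the negative part of that function. -/
theorem sub_integral_negPart_le {m : ℝ} {f f' : ℝ → ℝ}
    (hf' : IntegrableOn f' (Set.Icc 0 m))
    (hrep : ∀ x ∈ Set.Icc (0 : ℝ) m, f x = f 0 + ∫ t in (0 : ℝ)..x, f' t)
    {x y : ℝ} (hx : 0 ≤ x) (hxy : x ≤ y) (hy : y ≤ m) :
    f x - ∫ t in Set.Icc (0 : ℝ) m, |min 0 (f' t)| ≤ f y := by
  have hint : ∀ a b : ℝ, 0 ≤ a → a ≤ b → b ≤ m → IntervalIntegrable f' volume a b := by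
    intro a b ha hab hb
    rw [intervalIntegrable_iff_integrableOn_Icc_of_le hab]
    exact hf'.mono_set (Set.Icc_subset_Icc ha hb)
  have hneg : IntegrableOn (fun t => |min 0 (f' t)|) (Set.Icc 0 m) :=
    ((integrable_zero ℝ ℝ (volume.restrict (Set.Icc 0 m))).inf hf').abs
  have hadd := intervalIntegral.integral_add_adjacent_intervals
    (hint 0 x le_rfl hx (hxy.trans hy)) (hint x y hx hxy hy)
  have hsub : Set.Ioc x y ⊆ Set.Icc 0 m :=
    fun t ht => ⟨hx.trans ht.1.le, ht.2.trans hy⟩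
  have hlow : -(∫ t in Set.Ioc x y, |min 0 (f' t)|) ≤ ∫ t in Set.Ioc x y, f' t := by
    rw [← integral_neg]
    refine integral_mono (hneg.mono_set hsub).neg (hf'.mono_set hsub) fun t => ?_
    have h := neg_abs_le (min 0 (f' t))
    exact h.trans (min_le_right _ _)
  have hmono : ∫ t in Set.Ioc x y, |min 0 (f' t)| ≤ ∫ t in Set.Icc 0 m, |min 0 (f' t)| :=
    setIntegral_mono_set hneg (Filter.Eventually.of_forall fun t => abs_nonneg _)
      hsub.eventuallyLE
  rw [intervalIntegral.integral_of_le hxy] at hadd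
  rw [hrep x ⟨hx, hxy.trans hy⟩, hrep y ⟨hx.trans hxy, hy⟩]
  linarith

/-- If a continuous function on `[0,m]` never decreases by more than `V`, then it is within `V`
of its monotone rearrangement. -/
theorem abs_sub_rearr1_le {m V : ℝ} {f : ℝ → ℝ} (hf : ContinuousOn f (Set.Icc 0 m))
    (hV : ∀ x y, 0 ≤ x → x ≤ y → y ≤ m → f x - V ≤ f y) {x : ℝ} (hx : x ∈ Set.Icc 0 m) :
    |f x - rearr1 m f x| ≤ V := by
  have hlow : ∀ c ∈ {c : ℝ | (levelSet m f c).Nonempty ∧ 0 ≤ x ∧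
      ENNReal.ofReal x ≤ volume (levelSet m f c)}, f x - V ≤ c := by
    rintro c ⟨⟨y, hy, hyc⟩, -, hvol⟩
    by_contra! hc
    have hV0 : 0 ≤ V := by linarith [hV x x hx.1 le_rfl hx.2]
    have hyx : y < x := by
      by_contra! hxy
      linarith [hV x y hx.1 hxy hy.2]
    obtain ⟨δ, hδ, hball⟩ := Metric.continuousWithinAt_iff.1 (hf x hx) (f x - c) (by linarith)
    have hsub : levelSet m f c ⊆ Set.Icc 0 (max 0 (x - δ)) := by
      rintro z ⟨hz, hzc⟩
      have hzx : z < x := by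
        by_contra! hxz
        linarith [hV x z hx.1 hxz hz.2]
      refine ⟨hz.1, le_max_of_le_right ?_⟩
      by_contra! hzδ
      have hd := hball hz (by rw [Real.dist_eq, abs_lt]; constructor <;> linarith)
      rw [Real.dist_eq, abs_lt] at hd
      linarith [hd.1]
    have hle := hvol.trans (measure_mono hsub)
    rw [Real.volume_Icc, sub_zero, ENNReal.ofReal_le_ofReal_iff (le_max_left _ _)] at hle
    rcases le_max_iff.1 hle with h | h
    · linarith [hy.1]
    · linarith
  have hmem : f x + V ∈ {c : ℝ | (levelSet m f c).Nonempty ∧ 0 ≤ x ∧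
      ENNReal.ofReal x ≤ volume (levelSet m f c)} := by
    have hsub : Set.Icc 0 x ⊆ levelSet m f (f x + V) := fun z hz =>
      ⟨⟨hz.1, hz.2.trans hx.2⟩, by linarith [hV z x hz.1 hz.2 hx.2]⟩
    refine ⟨⟨0, hsub ⟨le_rfl, hx.1⟩⟩, hx.1, ?_⟩
    calc ENNReal.ofReal x = volume (Set.Icc 0 x) := by rw [Real.volume_Icc, sub_zero]
      _ ≤ _ := measure_mono hsub
  have h1 : rearr1 m f x ≤ f x + V := csInf_le ⟨_, hlow⟩ hmem
  have h2 : f x - V ≤ rearr1 m f x := le_csInf ⟨_, hmem⟩ hlow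
  rw [abs_le]
  constructor <;> linarith

/-- **Directed `L¹`-Poincaré inequality on the line:** if `f : [0,m] → ℝ` is absolutely
continuous (with a.e. derivative `f' ∈ L¹(0,m)` and `f(x) = f(0) + ∫₀ˣ f'`), and `f*` is
its monotone rearrangement, then `∫₀ᵐ |f − f*| dν ≤ 2 m ∫₀ᵐ |∂⁻ f| dν`. -/
theorem directed_poincare_line (m : ℝ) (hm : 0 < m) (f f' : ℝ → ℝ)
    (hf' : IntegrableOn f' (Set.Icc 0 m))
    (hrep : ∀ x ∈ Set.Icc (0 : ℝ) m, f x = f 0 + ∫ t in (0 : ℝ)..x, f' t) :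
    (∫ x in Set.Icc (0 : ℝ) m, |f x - rearr1 m f x|) ≤
      2 * m * ∫ x in Set.Icc (0 : ℝ) m, |min 0 (f' x)| := by
  have hcont : ContinuousOn f (Set.Icc 0 m) := by
    have h := intervalIntegral.continuousOn_primitive_interval (a := 0) (b := m) (f := f')
      (μ := volume) (by rwa [Set.uIcc_of_le hm.le])
    rw [Set.uIcc_of_le hm.le] at h
    exact (continuousOn_const.add h).congr hrep
  have hV0 : 0 ≤ ∫ t in Set.Icc (0 : ℝ) m, |min 0 (f' t)| :=
    integral_nonneg fun t => abs_nonneg _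
  have hbound := norm_setIntegral_le_of_norm_le_const (μ := volume) (s := Set.Icc 0 m)
    (f := fun x => |f x - rearr1 m f x|) (by simp) fun x hx => by
      rw [Real.norm_eq_abs, abs_abs]
      exact abs_sub_rearr1_le hcont (fun _ _ => sub_integral_negPart_le hf' hrep) hx
  rw [Real.volume_real_Icc_of_le hm.le, sub_zero] at hbound
  have hmV := mul_nonneg hm.le hV0
  linarith [Real.le_norm_self (∫ x in Set.Icc (0 : ℝ) m, |f x - rearr1 m f x|)]
end

section
/- Let f : [m] → ℝ and let f* : [m] → ℝ be its monotone rearrangement, i.e., f*(1) ≤ f*(2) ≤ ⋯ ≤ f*(m) is the sorted sequence of the values f(1),…,f(m). Then Σ_{x=1}^m |f(x) − f*(x)| ≤ 2m · Σ_{x=1}^m |∂⁻f(x)|. -/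
/-- The discrete derivative `∂f(x) = f(x+1) − f(x)` for `x < m`, and `∂f(m) = 0`. -/
noncomputable def dLine {m : ℕ} (f : Fin m → ℝ) (x : Fin m) : ℝ :=
  if h : (x : ℕ) + 1 < m then f ⟨(x : ℕ) + 1, h⟩ - f x else 0

/-- A function on the line can only drop, between `x` and a later point, by the total size of its
negative derivatives. -/
theorem sub_le_sum_abs_min_dLine {m : ℕ} (f : Fin m → ℝ) {x y : Fin m} (hxy : x ≤ y) :
    f x - f y ≤ ∑ z, |min 0 (dLine f z)| := by
  have drop_le (n : ℕ) (hn : (x : ℕ) ≤ n) : ∀ h : n < m, f x - f ⟨n, h⟩ ≤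
      ∑ z ∈ Finset.univ.filter (fun z : Fin m => (z : ℕ) < n), |min 0 (dLine f z)| := by
    induction n, hn using Nat.le_induction with
    | base =>
      intro h
      simpa using Finset.sum_nonneg fun z _ => abs_nonneg (min 0 (dLine f z))
    | succ n hn ih =>
      intro h
      have hins : Finset.univ.filter (fun z : Fin m => (z : ℕ) < n + 1) =
          insert ⟨n, by omega⟩ (Finset.univ.filter (fun z : Fin m => (z : ℕ) < n)) := by
        ext z
        simp only [Finset.mem_filter, Finset.mem_univ, true_and, Finset.mem_insert, Fin.ext_iff]
        omega
      rw [hins, Finset.sum_insert (by simp)]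
      have hstep : f ⟨n, by omega⟩ - f ⟨n + 1, h⟩ ≤ |min 0 (dLine f ⟨n, by omega⟩)| := by
        have hd : dLine f ⟨n, by omega⟩ = f ⟨n + 1, h⟩ - f ⟨n, by omega⟩ := by simp [dLine, h]
        rw [hd]
        linarith [neg_le_abs (min 0 (f ⟨n + 1, h⟩ - f ⟨n, by omega⟩)),
          min_le_right 0 (f ⟨n + 1, h⟩ - f ⟨n, by omega⟩)]
      linarith [ih (by omega)]
  exact (drop_le y hxy y.isLt).trans
    (Finset.sum_le_sum_of_subset_of_nonneg (Finset.filter_subset _ _) fun _ _ _ => abs_nonneg _)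

/-- A permutation cannot map an initial segment into a strictly smaller one. -/
theorem exists_le_and_le_perm {m : ℕ} (σ : Equiv.Perm (Fin m)) (x : Fin m) :
    ∃ i ≤ x, x ≤ σ i := by
  by_contra! h
  have hcard := Finset.card_le_card_of_injOn (s := Finset.Iic x) (t := Finset.Iio x) σ
    (fun i hi => by simpa using h i (by simpa using hi)) σ.injective.injOn
  simp at hcard

/-- The pointwise distance between `f` and its sorted rearrangement is at most the total size of
the negative derivatives of `f`. -/
theorem abs_sub_sortTuple_le {m : ℕ} (f : Fin m → ℝ) (x : Fin m) :
    |f x - sortTuple f x| ≤ ∑ z, |min 0 (dLine f z)| := by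
  have hmono : Monotone (sortTuple f) := Tuple.monotone_sort f
  obtain ⟨i, hix, hxi⟩ := exists_le_and_le_perm (Tuple.sort f) x
  obtain ⟨j, hjx, hxj⟩ := exists_le_and_le_perm (Tuple.sort f).symm x
  have hi : f (Tuple.sort f i) ≤ sortTuple f x := hmono hix
  have hj : sortTuple f x ≤ f j := by simpa [sortTuple] using hmono hxj
  rw [abs_le]
  constructor
  · linarith [sub_le_sum_abs_min_dLine f hjx]
  · linarith [sub_le_sum_abs_min_dLine f hxi]

/-- **Directed `L¹`-Poincaré inequality on the discrete line:**
`Σₓ |f(x) − f*(x)| ≤ 2 m Σₓ |∂⁻ f(x)|`, where `f*` is the sorted rearrangement of `f`. -/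
theorem directed_poincare_discrete_line {m : ℕ} (f : Fin m → ℝ) :
    ∑ x, |f x - sortTuple f x| ≤ 2 * m * ∑ x, |min 0 (dLine f x)| := by
  have hsum : ∑ x, |f x - sortTuple f x| ≤ m * ∑ x, |min 0 (dLine f x)| := by
    simpa using Finset.sum_le_card_nsmul Finset.univ _ _ fun x _ => abs_sub_sortTuple_le f x
  have hnonneg : 0 ≤ m * ∑ x, |min 0 (dLine f x)| := by positivity
  linarith
end

section
/- Let B̄ ⊂ ℝⁿ be the closure of a box B = (0,a₁) × ⋯ × (0,aₙ) and let f : B̄ → ℝ be Lipschitz continuous. Then its monotone rearrangement f* = R_n R_{n-1} ⋯ R_1 f is a monotone function, i.e., f*(x) ≤ f*(y) whenever x_i ≤ y_i for every i ∈ [n]. -/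
open MeasureTheory

theorem levelSet_eq_Icc {m B : ℝ} {g : ℝ → ℝ} (hg : ∀ t ∈ Set.Icc 0 m, g t ≤ B) :
    levelSet m g B = Set.Icc 0 m :=
  Set.ext fun t => ⟨fun h => h.1, fun h => ⟨h, hg t h⟩⟩

/-- An upper bound of `g` on `[0,m]` is admissible in the infimum defining `rearr1 m g x`. -/
theorem mem_rearr1_set {m B x : ℝ} {g : ℝ → ℝ} (hg : ∀ t ∈ Set.Icc 0 m, g t ≤ B)
    (hx : x ∈ Set.Icc 0 m) :
    B ∈ {c : ℝ | (levelSet m g c).Nonempty ∧ 0 ≤ x ∧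
      ENNReal.ofReal x ≤ volume (levelSet m g c)} := by
  refine ⟨?_, hx.1, ?_⟩
  · rw [levelSet_eq_Icc hg]
    exact ⟨x, hx⟩
  · rw [levelSet_eq_Icc hg, Real.volume_Icc, sub_zero]
    exact ENNReal.ofReal_le_ofReal hx.2

/-- A lower bound of `g` on `[0,m]` is a lower bound of the set defining `rearr1 m g x`. -/
theorem mem_lowerBounds_rearr1_set {m A : ℝ} {g : ℝ → ℝ} (hg : ∀ t ∈ Set.Icc 0 m, A ≤ g t)
    (x : ℝ) :
    A ∈ lowerBounds {c : ℝ | (levelSet m g c).Nonempty ∧ 0 ≤ x ∧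
      ENNReal.ofReal x ≤ volume (levelSet m g c)} := by
  rintro c ⟨⟨t, ht, htc⟩, -⟩
  exact (hg t ht).trans htc

theorem rearr1_mem_Icc {m A B x : ℝ} {g : ℝ → ℝ} (hg : ∀ t ∈ Set.Icc 0 m, g t ∈ Set.Icc A B)
    (hx : x ∈ Set.Icc 0 m) : rearr1 m g x ∈ Set.Icc A B := by
  have hB := mem_rearr1_set (fun t ht => (hg t ht).2) hx
  have hA := mem_lowerBounds_rearr1_set (fun t ht => (hg t ht).1) x
  exact ⟨le_csInf ⟨B, hB⟩ hA, csInf_le ⟨A, hA⟩ hB⟩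

/-- The one-dimensional rearrangement is monotone jointly in the function and the point. -/
theorem rearr1_le_rearr1 {m A B x y : ℝ} {g h : ℝ → ℝ} (hA : ∀ t ∈ Set.Icc 0 m, A ≤ g t)
    (hB : ∀ t ∈ Set.Icc 0 m, h t ≤ B) (hgh : ∀ t ∈ Set.Icc 0 m, g t ≤ h t)
    (hx : 0 ≤ x) (hxy : x ≤ y) (hy : y ≤ m) : rearr1 m g x ≤ rearr1 m h y := by
  refine csInf_le_csInf ⟨A, mem_lowerBounds_rearr1_set hA x⟩
    ⟨B, mem_rearr1_set hB ⟨hx.trans hxy, hy⟩⟩ ?_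
  rintro c ⟨hne, -, hvol⟩
  have hsub : levelSet m h c ⊆ levelSet m g c := fun t ht => ⟨ht.1, (hgh t ht.1).trans ht.2⟩
  exact ⟨hne.mono hsub, hx,
    (ENNReal.ofReal_le_ofReal hxy).trans (hvol.trans (measure_mono hsub))⟩

theorem update_mem_Icc_zero {n : ℕ} {a x : Fin n → ℝ} (hx : x ∈ Set.Icc 0 a) {i : Fin n} {t : ℝ}
    (ht : t ∈ Set.Icc 0 (a i)) : Function.update x i t ∈ Set.Icc 0 a :=
  ⟨le_update_iff.2 ⟨ht.1, fun j _ => hx.1 j⟩, update_le_iff.2 ⟨ht.2, fun j _ => hx.2 j⟩⟩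

theorem rearrDir_mem_Icc {n : ℕ} {a : Fin n → ℝ} {A B : ℝ} {g : (Fin n → ℝ) → ℝ}
    (hg : ∀ x ∈ Set.Icc 0 a, g x ∈ Set.Icc A B) (i : Fin n) {x : Fin n → ℝ}
    (hx : x ∈ Set.Icc 0 a) : rearrDir a i g x ∈ Set.Icc A B :=
  rearr1_mem_Icc (fun _ ht => hg _ (update_mem_Icc_zero hx ht)) ⟨hx.1 i, hx.2 i⟩

/-- `g` is monotone on the box `[0,a]` in the coordinates belonging to `S`. -/
def MonotoneInCoords {n : ℕ} (a : Fin n → ℝ) (S : Set (Fin n)) (g : (Fin n → ℝ) → ℝ) : Prop :=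
  ∀ x ∈ Set.Icc 0 a, ∀ y ∈ Set.Icc 0 a, x ≤ y → (∀ i ∉ S, x i = y i) → g x ≤ g y

/-- Rearranging in direction `i` produces monotonicity in direction `i` and keeps monotonicity
in the other directions. -/
theorem MonotoneInCoords.rearrDir {n : ℕ} {a : Fin n → ℝ} {S : Set (Fin n)} {A B : ℝ}
    {g : (Fin n → ℝ) → ℝ} (hS : MonotoneInCoords a S g)
    (hg : ∀ x ∈ Set.Icc 0 a, g x ∈ Set.Icc A B) (i : Fin n) :
    MonotoneInCoords a (insert i S) (rearrDir a i g) := by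
  intro x hx y hy hxy heq
  refine rearr1_le_rearr1 (fun t ht => (hg _ (update_mem_Icc_zero hx ht)).1)
    (fun t ht => (hg _ (update_mem_Icc_zero hy ht)).2) (fun t ht => ?_) (hx.1 i) (hxy i) (hy.2 i)
  refine hS _ (update_mem_Icc_zero hx ht) _ (update_mem_Icc_zero hy ht)
    (update_le_update_iff.2 ⟨le_rfl, fun j _ => hxy j⟩) fun j hj => ?_
  rcases eq_or_ne j i with rfl | hji
  · simp
  · simpa [hji] using heq j (by simp [hji, hj])

theorem MonotoneInCoords.foldl_rearrDir {n : ℕ} {a : Fin n → ℝ} {A B : ℝ} (l : List (Fin n))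
    {S : Set (Fin n)} {g : (Fin n → ℝ) → ℝ} (hS : MonotoneInCoords a S g)
    (hg : ∀ x ∈ Set.Icc 0 a, g x ∈ Set.Icc A B) :
    MonotoneInCoords a (S ∪ {i | i ∈ l}) (l.foldl (fun g i => _root_.rearrDir a i g) g) := by
  induction l generalizing S g with
  | nil => simpa using hS
  | cons i l ih =>
    have hunion : S ∪ {j | j ∈ i :: l} = insert i S ∪ {j | j ∈ l} := by
      ext j
      simp only [List.mem_cons, Set.mem_union, Set.mem_ofPred_eq, Set.mem_insert_iff]
      tauto
    rw [hunion]
    exact ih (hS.rearrDir hg i) fun x hx => rearrDir_mem_Icc hg i hx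

/-- **The monotone rearrangement is monotone:** for a Lipschitz function `f` on the box
`[0,a₁] × ⋯ × [0,aₙ]`, the rearrangement `f* = Rₙ ⋯ R₁ f` satisfies `f*(x) ≤ f*(y)`
whenever `xᵢ ≤ yᵢ` for every `i`. -/
theorem monoRearr_monotone {n : ℕ} (a : Fin n → ℝ) (ha : ∀ i, 0 < a i) (K : NNReal)
    (f : (Fin n → ℝ) → ℝ) (hf : LipschitzOnWith K f (Set.Icc 0 a)) :
    MonotoneOn (monoRearr a f) (Set.Icc 0 a) := by
  obtain ⟨A, hA⟩ := isCompact_Icc.bddBelow_image hf.continuousOn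
  obtain ⟨B, hB⟩ := isCompact_Icc.bddAbove_image hf.continuousOn
  have hbound : ∀ x ∈ Set.Icc 0 a, f x ∈ Set.Icc A B := fun x hx =>
    ⟨hA (Set.mem_image_of_mem f hx), hB (Set.mem_image_of_mem f hx)⟩
  have hempty : MonotoneInCoords a ∅ f := fun x _ y _ _ heq =>
    (congrArg f (funext fun i => heq i (Set.notMem_empty i))).le
  intro x hx y hy hxy
  exact hempty.foldl_rearrDir (List.finRange n) hbound x hx y hy hxy
    fun i hi => absurd (Or.inr (List.mem_finRange i)) hi
end

section
/- Let B̄ ⊂ ℝⁿ be the closure of a box B = (0,a₁) × ⋯ × (0,aₙ), let f : B̄ → ℝ be Lipschitz continuous, and let i, j ∈ [n]. Then ∫_B |∂⁻_j (R_i f)| dν ≤ ∫_B |∂⁻_j f| dν, where R_i is the rearrangement operator in direction i and ν is the Lebesgue measure. -/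
open MeasureTheory

section Rearrangement

open Filter Topology

theorem levelSet_eq (m : ℝ) (g : ℝ → ℝ) (c : ℝ) :
    levelSet m g c = g ⁻¹' Set.Iic c ∩ Set.Icc 0 m := by
  ext y
  simp [levelSet, and_comm]

theorem measurableSet_levelSet {m : ℝ} {g : ℝ → ℝ} (hg : Continuous g) (c : ℝ) :
    MeasurableSet (levelSet m g c) := by
  rw [levelSet_eq]
  exact (hg.measurable measurableSet_Iic).inter measurableSet_Icc

theorem volume_levelSet_le (m : ℝ) (g : ℝ → ℝ) (c : ℝ) :
    volume (levelSet m g c) ≤ ENNReal.ofReal m := by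
  calc volume (levelSet m g c) ≤ volume (Set.Icc 0 m) := measure_mono fun y hy => hy.1
    _ = ENNReal.ofReal m := by simp

theorem rearr1_congr {m : ℝ} {g h : ℝ → ℝ} (hgh : Set.EqOn g h (Set.Icc 0 m)) (t : ℝ) :
    rearr1 m g t = rearr1 m h t := by
  have : levelSet m g = levelSet m h := by
    ext c y
    exact and_congr_right fun hy => by rw [hgh hy]
  rw [rearr1, rearr1, this]

/-- The rearrangement is the generalized inverse of the distribution function of `g`. -/
theorem rearr1_le_iff_s8 {m : ℝ} {g : ℝ → ℝ} (hg : Continuous g) {t : ℝ} (ht : t ∈ Set.Ioo 0 m)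
    (c : ℝ) : rearr1 m g t ≤ c ↔ ENNReal.ofReal t ≤ volume (levelSet m g c) := by
  constructor
  · intro hc
    have key : ∀ d > c, ENNReal.ofReal t ≤ volume (levelSet m g d) := by
      intro d hd
      have hne : {c : ℝ | (levelSet m g c).Nonempty ∧ 0 ≤ t ∧
          ENNReal.ofReal t ≤ volume (levelSet m g c)}.Nonempty := by
        obtain ⟨M, hM⟩ := (isCompact_Icc (a := (0 : ℝ)) (b := m)).bddAbove_image hg.continuousOn
        have hset : levelSet m g M = Set.Icc 0 m := by
          ext y
          exact ⟨fun hy => hy.1, fun hy => ⟨hy, hM ⟨y, hy, rfl⟩⟩⟩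
        refine ⟨M, ?_, ht.1.le, ?_⟩
        · rw [hset]
          exact ⟨t, ht.1.le, ht.2.le⟩
        · rw [hset, Real.volume_Icc, sub_zero]
          exact ENNReal.ofReal_le_ofReal ht.2.le
      obtain ⟨e, he, hed⟩ := exists_lt_of_csInf_lt hne (lt_of_le_of_lt hc hd)
      exact he.2.2.trans (measure_mono fun y hy => ⟨hy.1, hy.2.trans hed.le⟩)
    have hlim := tendsto_measure_biInter_gt (μ := volume) (s := levelSet m g) (a := c)
      (fun r _ => (measurableSet_levelSet hg r).nullMeasurableSet)
      (fun r r' _ hr y hy => ⟨hy.1, hy.2.trans hr⟩)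
      ⟨c + 1, by simp, ((volume_levelSet_le m g _).trans_lt ENNReal.ofReal_lt_top).ne⟩
    have hinter : (⋂ r, ⋂ (_ : r > c), levelSet m g r) = levelSet m g c := by
      ext y
      simp only [Set.mem_iInter]
      refine ⟨fun hy => ⟨(hy (c + 1) (by simp)).1, ?_⟩, fun hy r hr => ⟨hy.1, hy.2.trans hr.le⟩⟩
      exact le_of_forall_gt_imp_ge_of_dense fun r hr => (hy r hr).2
    rw [hinter] at hlim
    exact ge_of_tendsto hlim (eventually_nhdsWithin_of_forall key)
  · intro hc
    refine csInf_le ?_ ⟨?_, ht.1.le, hc⟩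
    · obtain ⟨M, hM⟩ := (isCompact_Icc (a := (0 : ℝ)) (b := m)).bddBelow_image hg.continuousOn
      refine ⟨M, ?_⟩
      rintro d ⟨⟨y, hy⟩, -⟩
      exact (hM ⟨y, hy.1, rfl⟩).trans hy.2
    · refine nonempty_of_measure_ne_zero (μ := volume) (ne_of_gt ?_)
      exact lt_of_lt_of_le (ENNReal.ofReal_pos.2 ht.1) hc

theorem rearr1_monotoneOn_s8 {m : ℝ} {g : ℝ → ℝ} (hg : Continuous g) :
    MonotoneOn (rearr1 m g) (Set.Ioo 0 m) := by
  intro s hs t ht hst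
  rw [rearr1_le_iff_s8 hg hs]
  exact (ENNReal.ofReal_le_ofReal hst).trans ((rearr1_le_iff_s8 hg ht _).1 le_rfl)

theorem rearr1_mono {m : ℝ} {g h : ℝ → ℝ} (hg : Continuous g) (hh : Continuous h)
    (hgh : ∀ y, g y ≤ h y) {t : ℝ} (ht : t ∈ Set.Ioo 0 m) : rearr1 m g t ≤ rearr1 m h t := by
  rw [rearr1_le_iff_s8 hg ht]
  exact ((rearr1_le_iff_s8 hh ht _).1 le_rfl).trans
    (measure_mono fun y hy => ⟨hy.1, (hgh y).trans hy.2⟩)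

/-- A function and its rearrangement are equimeasurable. -/
theorem identDistrib_rearr1 (m : ℝ) {g : ℝ → ℝ} (hg : Continuous g) :
    ProbabilityTheory.IdentDistrib (rearr1 m g) g
      (volume.restrict (Set.Ioo 0 m)) (volume.restrict (Set.Ioo 0 m)) := by
  have hr : AEMeasurable (rearr1 m g) (volume.restrict (Set.Ioo 0 m)) :=
    aemeasurable_restrict_of_monotoneOn measurableSet_Ioo (rearr1_monotoneOn_s8 hg)
  refine ⟨hr, hg.aemeasurable, ?_⟩
  refine Measure.ext_of_Iic _ _ fun c => ?_
  rw [Measure.map_apply_of_aemeasurable hr measurableSet_Iic,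
    Measure.map_apply hg.measurable measurableSet_Iic,
    Measure.restrict_apply' measurableSet_Ioo]
  have hv : volume.restrict (Set.Ioo 0 m) (g ⁻¹' Set.Iic c) = volume (levelSet m g c) := by
    rw [Measure.restrict_congr_set Ioo_ae_eq_Icc, Measure.restrict_apply' measurableSet_Icc,
      levelSet_eq]
  rw [hv]
  have hfin : volume (levelSet m g c) ≠ ⊤ :=
    ((volume_levelSet_le m g c).trans_lt ENNReal.ofReal_lt_top).ne
  obtain ⟨v, hv0, hv⟩ : ∃ v : ℝ, 0 ≤ v ∧ volume (levelSet m g c) = ENNReal.ofReal v :=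
    ⟨_, ENNReal.toReal_nonneg, (ENNReal.ofReal_toReal hfin).symm⟩
  have hset : rearr1 m g ⁻¹' Set.Iic c ∩ Set.Ioo 0 m = Set.Iic v ∩ Set.Ioo 0 m := by
    ext t
    simp only [Set.mem_inter_iff, Set.mem_preimage, Set.mem_Iic]
    refine and_congr_left fun ht => ?_
    rw [rearr1_le_iff_s8 hg ht, hv, ENNReal.ofReal_le_ofReal_iff hv0]
  have hvm : ENNReal.ofReal v ≤ ENNReal.ofReal m := hv ▸ volume_levelSet_le m g c
  rw [hset, hv]
  apply le_antisymm
  · calc volume (Set.Iic v ∩ Set.Ioo 0 m) ≤ volume (Set.Icc 0 v) :=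
          measure_mono fun t ht => ⟨ht.2.1.le, ht.1⟩
      _ = ENNReal.ofReal v := by simp
  · calc ENNReal.ofReal v = volume (Set.Ioo 0 v) := by simp
      _ ≤ volume (Set.Iic v ∩ Set.Ioo 0 m) := by
        refine measure_mono fun t ht => ⟨ht.2.le, ht.1, ht.2.trans_le ?_⟩
        by_contra! hlt
        exact absurd hvm (not_le.2 ((ENNReal.ofReal_lt_ofReal_iff (ht.1.trans ht.2)).2 hlt))

/-- Rearrangement is an order-preserving contraction for the positive part of the difference. -/
theorem lintegral_rearr1_sub_le (m : ℝ) {g h : ℝ → ℝ} (hg : Continuous g) (hh : Continuous h) :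
    ∫⁻ t in Set.Ioo 0 m, ENNReal.ofReal (rearr1 m g t - rearr1 m h t) ≤
      ∫⁻ t in Set.Ioo 0 m, ENNReal.ofReal (g t - h t) := by
  set k : ℝ → ℝ := fun y => min (g y) (h y) with hk_def
  have hk : Continuous k := hg.min hh
  have hint : ∀ {u : ℝ → ℝ}, Continuous u → IntegrableOn u (Set.Ioo 0 m) := fun hu =>
    (hu.continuousOn.integrableOn_Icc).mono_set Set.Ioo_subset_Icc_self
  have hintR : ∀ {u : ℝ → ℝ}, Continuous u → IntegrableOn (rearr1 m u) (Set.Ioo 0 m) := fun hu =>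
    (identDistrib_rearr1 m hu).integrable_iff.2 (hint hu)
  calc ∫⁻ t in Set.Ioo 0 m, ENNReal.ofReal (rearr1 m g t - rearr1 m h t)
      ≤ ∫⁻ t in Set.Ioo 0 m, ENNReal.ofReal (rearr1 m g t - rearr1 m k t) := by
        refine setLIntegral_mono' measurableSet_Ioo fun t ht => ENNReal.ofReal_le_ofReal ?_
        exact sub_le_sub_left (rearr1_mono hk hh (fun y => min_le_right _ _) ht) _
    _ = ENNReal.ofReal (∫ t in Set.Ioo 0 m, (rearr1 m g t - rearr1 m k t)) := by
        refine (ofReal_integral_eq_lintegral_ofReal ((hintR hg).sub (hintR hk)) ?_).symm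
        filter_upwards [ae_restrict_mem measurableSet_Ioo] with t ht
        exact sub_nonneg.2 (rearr1_mono hk hg (fun y => min_le_left _ _) ht)
    _ = ENNReal.ofReal (∫ t in Set.Ioo 0 m, (g t - k t)) := by
        rw [integral_sub (hintR hg) (hintR hk), integral_sub (hint hg) (hint hk),
          (identDistrib_rearr1 m hg).integral_eq, (identDistrib_rearr1 m hk).integral_eq]
    _ = ∫⁻ t in Set.Ioo 0 m, ENNReal.ofReal (g t - k t) :=
        ofReal_integral_eq_lintegral_ofReal ((hint hg).sub (hint hk))
          (ae_of_all _ fun t => sub_nonneg.2 (min_le_left _ _))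
    _ = ∫⁻ t in Set.Ioo 0 m, ENNReal.ofReal (g t - h t) := by
        refine lintegral_congr fun t => ?_
        rcases le_total (g t) (h t) with hle | hle
        · simp [hk_def, hle, ENNReal.ofReal_of_nonpos (sub_nonpos.2 hle)]
        · simp [hk_def, hle]

section Directional

variable {n : ℕ}

theorem lipschitzWith_comp_update {K : NNReal} {f : (Fin n → ℝ) → ℝ} (hf : LipschitzWith K f)
    (j : Fin n) (x : Fin n → ℝ) : LipschitzWith K fun t => f (Function.update x j t) := by
  refine LipschitzWith.of_dist_le_mul fun s t => (hf.dist_le_mul _ _).trans ?_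
  gcongr
  refine (dist_pi_le_iff dist_nonneg).2 fun l => ?_
  rcases eq_or_ne l j with rfl | hl <;> simp [*]

theorem measurable_indicator_rearrDir (a : Fin n → ℝ) (i : Fin n) {f : (Fin n → ℝ) → ℝ}
    (hf : Continuous f) :
    Measurable ({x : Fin n → ℝ | x i ∈ Set.Ioo 0 (a i)}.indicator (rearrDir a i f)) := by
  set S := {x : Fin n → ℝ | x i ∈ Set.Ioo 0 (a i)} with hS_def
  have hS : MeasurableSet S := measurable_pi_apply i measurableSet_Ioo
  refine measurable_of_Iic fun c => ?_
  have hvol : Measurable fun x : Fin n → ℝ =>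
      volume (levelSet (a i) (fun t => f (Function.update x i t)) c) := by
    have hT : MeasurableSet {p : (Fin n → ℝ) × ℝ |
        p.2 ∈ Set.Icc 0 (a i) ∧ f (Function.update p.1 i p.2) ≤ c} :=
      (measurable_snd measurableSet_Icc).inter
        (measurableSet_le
          (hf.comp (continuous_fst.update i continuous_snd)).measurable measurable_const)
    exact measurable_measure_prodMk_left hT
  have hset : S.indicator (rearrDir a i f) ⁻¹' Set.Iic c =
      (S ∩ {x | ENNReal.ofReal (x i) ≤
        volume (levelSet (a i) (fun t => f (Function.update x i t)) c)}) ∪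
      (Sᶜ ∩ {_x | 0 ≤ c}) := by
    ext x
    by_cases hx : x ∈ S
    · simp only [Set.mem_preimage, Set.indicator_of_mem hx, Set.mem_Iic, Set.mem_union,
        Set.mem_inter_iff, hx, true_and, Set.mem_compl_iff, not_true_eq_false, false_and, or_false,
        Set.mem_ofPred_eq]
      exact rearr1_le_iff_s8 (hf.comp (continuous_const.update i continuous_id)) hx c
    · simp [hx]
  rw [hset]
  exact (hS.inter (measurableSet_le
    (ENNReal.measurable_ofReal.comp (measurable_pi_apply i)) hvol)).union
    (hS.compl.inter (MeasurableSet.const _))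

/-- The negative part of the difference quotient of `f` in direction `j` with step `h`. -/
noncomputable def negDiffQuot (j : Fin n) (f : (Fin n → ℝ) → ℝ) (h : ℝ) (x : Fin n → ℝ) :
    ENNReal :=
  ENNReal.ofReal ((f x - f (Function.update x j (x j + h))) / h)

theorem measurable_negDiffQuot (j : Fin n) {f : (Fin n → ℝ) → ℝ} (hf : Measurable f) (h : ℝ) :
    Measurable (negDiffQuot j f h) := by
  have hu : Measurable fun x : Fin n → ℝ => Function.update x j (x j + h) :=
    (continuous_id.update j ((continuous_apply j).add continuous_const)).measurable
  exact ENNReal.measurable_ofReal.comp ((hf.sub (hf.comp hu)).div_const h)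

theorem tendsto_negDiffQuot {j : Fin n} {f : (Fin n → ℝ) → ℝ} {x : Fin n → ℝ}
    (hd : DifferentiableAt ℝ (fun t => f (Function.update x j t)) (x j)) :
    Tendsto (fun h => negDiffQuot j f h x) (𝓝[>] 0)
      (𝓝 (ENNReal.ofReal |min 0 (pdiff j f x)|)) := by
  have h1 := hd.hasDerivAt.tendsto_slope_zero_right.neg
  have h2 := (ENNReal.continuous_ofReal.tendsto _).comp h1
  have h3 : ENNReal.ofReal |min 0 (pdiff j f x)| = ENNReal.ofReal (-pdiff j f x) := by
    rcases le_total 0 (pdiff j f x) with h | h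
    · simp [h, ENNReal.ofReal_of_nonpos (neg_nonpos.2 h)]
    · rw [min_eq_right h, abs_of_nonpos h]
  rw [h3]
  refine h2.congr fun h => ?_
  simp only [Function.comp, negDiffQuot, Function.update_eq_self, smul_eq_mul]
  congr 1
  ring

theorem negPart_pdiff_le_liminf (j : Fin n) (f : (Fin n → ℝ) → ℝ) (x : Fin n → ℝ) {h : ℕ → ℝ}
    (hh : Tendsto h atTop (𝓝[>] 0)) :
    ENNReal.ofReal |min 0 (pdiff j f x)| ≤
      liminf (fun k => negDiffQuot j f (h k) x) atTop := by
  by_cases hd : DifferentiableAt ℝ (fun t => f (Function.update x j t)) (x j)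
  · exact ((tendsto_negDiffQuot hd).comp hh).liminf_eq.ge
  · simp [pdiff, deriv_zero_of_not_differentiableAt hd]

theorem lintegral_negDiffQuot_rearrDir_le (a : Fin n → ℝ) {i j : Fin n} (hij : j ≠ i)
    {f : (Fin n → ℝ) → ℝ} (hf : Continuous f) {h : ℝ} (hh : 0 < h) :
    ∫⁻ x in Set.univ.pi fun k => Set.Ioo 0 (a k),
        negDiffQuot j ({x : Fin n → ℝ | x i ∈ Set.Ioo 0 (a i)}.indicator (rearrDir a i f)) h x ≤
      ∫⁻ x in Set.univ.pi fun k => Set.Ioo 0 (a k), negDiffQuot j f h x := by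
  rw [volume_pi, Measure.restrict_pi_pi]
  refine lintegral_le_of_lmarginal_le {i}
    (measurable_negDiffQuot j (measurable_indicator_rearrDir a i hf) h)
    (measurable_negDiffQuot j hf.measurable h) fun x => ?_
  simp only [lmarginal_singleton]
  set y : Fin n → ℝ := Function.update x j (x j + h) with hy
  have hcomm : ∀ t, Function.update (Function.update x i t) j
      (Function.update x i t j + h) = Function.update y i t := fun t => by
    rw [Function.update_of_ne hij, Function.update_comm hij.symm]
  have hcont : ∀ z : Fin n → ℝ, Continuous fun t => f (Function.update z i t) := fun z =>
    hf.comp (continuous_const.update i continuous_id)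
  have hdiv : ∀ r : ℝ, ENNReal.ofReal (r / h) = ENNReal.ofReal r * ENNReal.ofReal h⁻¹ := fun r => by
    rw [div_eq_mul_inv, ENNReal.ofReal_mul' (inv_nonneg.2 hh.le)]
  simp only [negDiffQuot, hcomm, hdiv]
  rw [lintegral_mul_const' _ _ ENNReal.ofReal_ne_top,
    lintegral_mul_const' _ _ ENNReal.ofReal_ne_top]
  gcongr ?_ * _
  refine le_trans (le_of_eq ?_) (lintegral_rearr1_sub_le (a i) (hcont x) (hcont y))
  refine setLIntegral_congr_fun measurableSet_Ioo fun t ht => ?_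
  have hmem : ∀ z : Fin n → ℝ, Function.update z i t ∈ {x : Fin n → ℝ | x i ∈ Set.Ioo 0 (a i)} :=
    fun z => by simpa using ht
  simp only [Set.indicator_of_mem (hmem _), rearrDir, Function.update_self, Function.update_idem]

theorem differentiableAt_comp_update {f : (Fin n → ℝ) → ℝ} {x : Fin n → ℝ}
    (hf : DifferentiableAt ℝ f x) (j : Fin n) :
    DifferentiableAt ℝ (fun t => f (Function.update x j t)) (x j) := by
  refine DifferentiableAt.comp (x j) (g := f) ?_ (hasDerivAt_update x j (x j)).differentiableAt
  rwa [Function.update_eq_self]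

theorem measurable_pdiff_s8 (j : Fin n) {f : (Fin n → ℝ) → ℝ} (hf : Continuous f) :
    Measurable (pdiff j f) := by
  have h := measurable_deriv_with_param (f := fun (x : Fin n → ℝ) t => f (Function.update x j t))
    (hf.comp (continuous_fst.update j continuous_snd))
  exact h.comp (measurable_id.prodMk (measurable_pi_apply j))

theorem pdiff_congr {f g : (Fin n → ℝ) → ℝ} {s : Set (Fin n → ℝ)} (hs : IsOpen s)
    (hfg : Set.EqOn f g s) {x : Fin n → ℝ} (hx : x ∈ s) (j : Fin n) :
    pdiff j f x = pdiff j g x := by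
  refine EventuallyEq.deriv_eq ?_
  have hc : Tendsto (Function.update x j) (𝓝 (x j)) (𝓝 x) := by
    simpa using (hasDerivAt_update x j (x j)).continuousAt.tendsto
  filter_upwards [hc (hs.mem_nhds hx)] with t ht
  exact hfg ht

theorem pdiff_rearrDir_self_nonneg (a : Fin n → ℝ) (i : Fin n) {f : (Fin n → ℝ) → ℝ}
    (hf : Continuous f) {x : Fin n → ℝ} (hx : x i ∈ Set.Ioo 0 (a i)) :
    0 ≤ pdiff i (rearrDir a i f) x := by
  have hmono := rearr1_monotoneOn_s8 (m := a i)
    (hf.comp ((continuous_const (y := x)).update i continuous_id))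
  have heq : (fun t => rearrDir a i f (Function.update x i t)) =
      rearr1 (a i) (f ∘ fun t => Function.update x i t) := by
    ext t
    simp [rearrDir, Function.comp_def]
  rw [pdiff, heq, ← derivWithin_of_isOpen isOpen_Ioo hx]
  exact hmono.derivWithin_nonneg

theorem lintegral_negPart_pdiff_rearrDir_le (a : Fin n → ℝ) (i j : Fin n) {K : NNReal}
    {f : (Fin n → ℝ) → ℝ} (hf : LipschitzWith K f) :
    ∫⁻ x in Set.univ.pi fun k => Set.Ioo 0 (a k),
        ENNReal.ofReal |min 0 (pdiff j (rearrDir a i f) x)| ≤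
      ∫⁻ x in Set.univ.pi fun k => Set.Ioo 0 (a k), ENNReal.ofReal |min 0 (pdiff j f x)| := by
  set B : Set (Fin n → ℝ) := Set.univ.pi fun k => Set.Ioo 0 (a k) with hB_def
  have hB : MeasurableSet B := MeasurableSet.univ_pi fun k => measurableSet_Ioo
  rcases eq_or_ne j i with rfl | hij
  · refine setLIntegral_mono' hB fun x hx => ?_
    rw [min_eq_left (pdiff_rearrDir_self_nonneg a j hf.continuous (hx j trivial))]
    simp
  set S : Set (Fin n → ℝ) := {x | x i ∈ Set.Ioo 0 (a i)} with hS_def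
  have hS : IsOpen S := isOpen_Ioo.preimage (continuous_apply i)
  set H := S.indicator (rearrDir a i f) with hH_def
  have hH : Measurable H := measurable_indicator_rearrDir a i hf.continuous
  set h : ℕ → ℝ := fun k => 1 / ((k : ℝ) + 1) with h_def
  have hpos : ∀ k, 0 < h k := fun k => Nat.one_div_pos_of_nat
  have hh : Tendsto h atTop (𝓝[>] 0) :=
    tendsto_nhdsWithin_iff.2 ⟨tendsto_one_div_add_atTop_nhds_zero_nat, Eventually.of_forall hpos⟩
  have hlim : Tendsto (fun k => ∫⁻ x in B, negDiffQuot j f (h k) x) atTop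
      (𝓝 (∫⁻ x in B, ENNReal.ofReal |min 0 (pdiff j f x)|)) := by
    refine tendsto_lintegral_of_dominated_convergence (fun _ => ENNReal.ofReal K)
      (fun k => measurable_negDiffQuot j hf.continuous.measurable (h k))
      (fun k => ae_of_all _ fun x => ENNReal.ofReal_le_ofReal ?_) ?_ ?_
    · rw [div_le_iff₀ (hpos k)]
      have := (lipschitzWith_comp_update hf j x).dist_le_mul (x j) (x j + h k)
      simp only [Function.update_eq_self, Real.dist_eq, sub_add_cancel_left, abs_neg,
        abs_of_pos (hpos k)] at this
      exact (le_abs_self _).trans this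
    · rw [setLIntegral_const, hB_def, Real.volume_pi_Ioo]
      exact ENNReal.mul_ne_top ENNReal.ofReal_ne_top
        (ENNReal.prod_ne_top fun k _ => ENNReal.ofReal_ne_top)
    · refine ae_restrict_of_ae ?_
      filter_upwards [hf.ae_differentiableAt] with x hx
      exact (tendsto_negDiffQuot (differentiableAt_comp_update hx j)).comp hh
  calc ∫⁻ x in B, ENNReal.ofReal |min 0 (pdiff j (rearrDir a i f) x)|
      = ∫⁻ x in B, ENNReal.ofReal |min 0 (pdiff j H x)| := by
        refine setLIntegral_congr_fun hB fun x hx => ?_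
        have : Set.EqOn (rearrDir a i f) H S := fun y hy => (Set.indicator_of_mem hy _).symm
        simp only [pdiff_congr hS this (show x ∈ S from hx i trivial) j]
    _ ≤ ∫⁻ x in B, liminf (fun k => negDiffQuot j H (h k) x) atTop :=
        lintegral_mono fun x => negPart_pdiff_le_liminf j H x hh
    _ ≤ liminf (fun k => ∫⁻ x in B, negDiffQuot j H (h k) x) atTop :=
        lintegral_liminf_le fun k => measurable_negDiffQuot j hH (h k)
    _ ≤ liminf (fun k => ∫⁻ x in B, negDiffQuot j f (h k) x) atTop :=
        liminf_le_liminf (Eventually.of_forall fun k =>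
          lintegral_negDiffQuot_rearrDir_le a hij hf.continuous (hpos k))
    _ = ∫⁻ x in B, ENNReal.ofReal |min 0 (pdiff j f x)| := hlim.liminf_eq

end Directional

end Rearrangement

/-- **Rearranging in direction `i` only decreases the violations of monotonicity in any
direction `j`:** for Lipschitz `f` on the box, `∫_B |∂⁻ⱼ (Rᵢ f)| dν ≤ ∫_B |∂⁻ⱼ f| dν`. -/
theorem rearrDir_decreases_violations {n : ℕ} (a : Fin n → ℝ) (ha : ∀ i, 0 < a i)
    (K : NNReal) (f : (Fin n → ℝ) → ℝ) (hf : LipschitzOnWith K f (Set.Icc 0 a))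
    (i j : Fin n) :
    (∫ x in Set.Icc (0 : Fin n → ℝ) a, |min 0 (pdiff j (rearrDir a i f) x)|) ≤
      ∫ x in Set.Icc (0 : Fin n → ℝ) a, |min 0 (pdiff j f x)| := by
  obtain ⟨g, hg, hfg⟩ := hf.extend_real
  set B : Set (Fin n → ℝ) := Set.univ.pi fun k => Set.Ioo 0 (a k) with hB_def
  have hB : MeasurableSet B := MeasurableSet.univ_pi fun k => measurableSet_Ioo
  have hBo : IsOpen B := isOpen_set_pi Set.finite_univ fun k _ => isOpen_Ioo
  have hBI : B ⊆ Set.Icc 0 a := fun x hx =>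
    ⟨fun k => (hx k trivial).1.le, fun k => (hx k trivial).2.le⟩
  have hae : B =ᵐ[volume] Set.Icc (0 : Fin n → ℝ) a :=
    Measure.univ_pi_Ioo_ae_eq_Icc (f := (0 : Fin n → ℝ))
  have hR : Set.EqOn (rearrDir a i f) (rearrDir a i g) B := fun x hx => by
    refine rearr1_congr (fun t ht => hfg ?_) _
    refine ⟨fun k => ?_, fun k => ?_⟩ <;> rcases eq_or_ne k i with rfl | hk
    · simpa using ht.1
    · simpa [hk] using (hBI hx).1 k
    · simpa using ht.2
    · simpa [hk] using (hBI hx).2 k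
  rw [← setIntegral_congr_set hae, ← setIntegral_congr_set hae,
    setIntegral_congr_fun hB (f := fun x => |min 0 (pdiff j (rearrDir a i f) x)|)
      (g := fun x => |min 0 (pdiff j (rearrDir a i g) x)|)
      (fun x hx => by simp only [pdiff_congr hBo hR hx j]),
    setIntegral_congr_fun hB (f := fun x => |min 0 (pdiff j f x)|)
      (g := fun x => |min 0 (pdiff j g x)|)
      (fun x hx => by simp only [pdiff_congr hBo (hfg.mono hBI) hx j])]
  have hbound : ∀ x, |min 0 (pdiff j g x)| ≤ K := fun x => by
    have h1 : |pdiff j g x| ≤ K := norm_deriv_le_of_lipschitz (lipschitzWith_comp_update hg j x)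
    refine le_trans ?_ h1
    rcases le_total 0 (pdiff j g x) with h | h <;> simp [h]
  have hfin : ∫⁻ x in B, ENNReal.ofReal |min 0 (pdiff j g x)| ≠ ⊤ := by
    refine ne_top_of_le_ne_top ?_
      (lintegral_mono fun x => ENNReal.ofReal_le_ofReal (hbound x))
    rw [setLIntegral_const, hB_def, Real.volume_pi_Ioo]
    exact ENNReal.mul_ne_top ENNReal.ofReal_ne_top
      (ENNReal.prod_ne_top fun k _ => ENNReal.ofReal_ne_top)
  rw [integral_eq_lintegral_of_nonneg_ae (f := fun x => |min 0 (pdiff j g x)|)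
    (ae_of_all _ fun x => abs_nonneg _)
    (measurable_const.min (measurable_pdiff_s8 j hg.continuous)).abs.aestronglyMeasurable]
  refine (Real.le_norm_self _).trans ((norm_integral_le_lintegral_norm _).trans ?_)
  refine ENNReal.toReal_mono hfin ?_
  simpa using lintegral_negPart_pdiff_rearrDir_le a i j hg
end
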